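/- Let M₀ and M_targ be compact subsets of ℝ³, and let Θ ⊂ ℝᵐ be compact. Let A : Diff_id^1(ℝ³) → 𝓛(V,V*) assign to each φ a bounded symmetric nonnegative operator, locally Lipschitz for the ‖·‖_{1,∞} distance, and suppose that for each γ > 0: (a) there exists ℓ_γ with ‖A_φ − A_ψ‖_{𝓛(V,V*)} ≤ ℓ_γ ‖φ − ψ‖_{1,∞}^{M₀} for all φ, ψ ∈ 𝔖_γ, and (b) the family {j(·,θ) : θ ∈ Θ} is equi-Lipschitz on 𝔖_γ: there exists ℓ'_γ with ‖j(φ,θ) − j(ψ,θ)‖_{V*} ≤ ℓ'_γ ‖φ − ψ‖_{1,∞}^{M₀} for all φ,ψ ∈ 𝔖_γ and all θ ∈ Θ. Suppose further that for each φ, θ_n → θ implies j(φ,θ_n) ⇀ j(φ,θ) weakly in V*; that there exists J_Θ with ‖j(φ,θ)‖_{V*} ≤ J_Θ for all φ ∈ Diff_id^1(ℝ³) and θ ∈ Θ; and that ρ is continuous with respect to ‖·‖_{1,∞}. Then the function θ ↦ ρ(φ_θ(T)(M₀), M_targ) attains its minimum over Θ, where φ_θ is the unique solution of the system φ(t) =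 id + ∫₀ᵗ v(s) ∘ φ(s) ds with v(s) = (ω K_V⁻¹ + A_{φ(s)})⁻¹ j(φ(s),θ). -/

import Mathlib

open MeasureTheory Filter Set
open scoped RealInnerProductSpace Topology

noncomputable section

/-- Euclidean 3-space. -/
abbrev E3 : Type := EuclideanSpace ℝ (Fin 3)

/-- The supremum over `ℝ³` of the norm of the `k`-th derivative of `v`. -/
def supDeriv (k : ℕ) (v : E3 → E3) : ℝ := ⨆ x : E3, ‖iteratedFDeriv ℝ k v x‖

/-- The norm `‖v‖_{s,∞} = Σ_{k ≤ s} sup_x |Dᵏ v(x)|`. -/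
def normS (s : ℕ) (v : E3 → E3) : ℝ := ∑ k ∈ Finset.range (s + 1), supDeriv k v

/-- The seminorm `‖v‖_{1,∞}^Ω = sup_{x ∈ Ω} |v(x)| + sup_{x ∈ Ω} |Dv(x)|`. -/
def normSOn (Ω : Set E3) (v : E3 → E3) : ℝ :=
  (⨆ x : Ω, ‖v (x : E3)‖) + ⨆ x : Ω, ‖fderiv ℝ v (x : E3)‖

/-- Membership in `C₀^s(ℝ³,ℝ³)`: `v` is `C^s` and all derivatives up to order `s`
tend to `0` at infinity. -/
def MemC0 (s : ℕ) (v : E3 → E3) : Prop :=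
  ContDiff ℝ s v ∧
    ∀ k ≤ s, Tendsto (fun x => ‖iteratedFDeriv ℝ k v x‖) (cocompact E3) (𝓝 0)

/-- `Diff_id^s(ℝ³)`: `C^s`-diffeomorphisms of `ℝ³` equal to the identity at infinity. -/
structure DiffId (s : ℕ) : Type where
  toFun : E3 → E3
  invFun : E3 → E3
  left_inv : Function.LeftInverse invFun toFun
  right_inv : Function.RightInverse invFun toFun
  memC0 : MemC0 s fun x => toFun x - x
  memC0_inv : MemC0 s fun x => invFun x - x

instance (s : ℕ) : CoeFun (DiffId s) fun _ => E3 → E3 := ⟨DiffId.toFun⟩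

/-- The distance `‖φ − ψ‖_{s,∞}` on `Diff_id^s(ℝ³)`. -/
def distS (s : ℕ) (φ ψ : DiffId s) : ℝ := normS s fun x => φ x - ψ x

/-- The set `𝔖_γ = {φ : ‖φ − id‖_{1,∞} ≤ γ and ‖φ⁻¹ − id‖_{1,∞} ≤ γ}`. -/
def Sgamma (γ : ℝ) : Set (DiffId 1) :=
  {φ | normS 1 (fun x => φ x - x) ≤ γ ∧ normS 1 (fun x => φ.invFun x - x) ≤ γ}

/-- `v` is the velocity `(ω K_V⁻¹ + B)⁻¹ j`, i.e. the unique minimizer of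
`(ω/2)‖·‖² + (1/2)(B · | ·) − (j | ·)`:  `ω⟪v,w⟫ + (Bv|w) = (j|w)` for all `w`. -/
def IsVel {V : Type*} [NormedAddCommGroup V] [InnerProductSpace ℝ V]
    (B : V →L[ℝ] V →L[ℝ] ℝ) (ω : ℝ) (j : V →L[ℝ] ℝ) (v : V) : Prop :=
  ∀ w : V, ω * ⟪v, w⟫ + B v w = j w

/-- `(φ, v)` solves the control system
`φ(t) = id + ∫₀ᵗ v(s) ∘ φ(s) ds`, `v(s) = (ω K_V⁻¹ + A_{φ(s)})⁻¹ j(s)` on `[0,T₀]`,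
with `t ↦ φ(t)` continuous into `Diff_id¹(ℝ³)`. -/
def IsSolution {V : Type*} [NormedAddCommGroup V] [InnerProductSpace ℝ V]
    (emb : V →ₗ[ℝ] (E3 → E3)) (ω : ℝ) (A : DiffId 1 → V →L[ℝ] V →L[ℝ] ℝ)
    (j : ℝ → V →L[ℝ] ℝ) (T₀ : ℝ) (φ : ℝ → DiffId 1) (v : ℝ → V) : Prop :=
  (∀ t ∈ Icc (0 : ℝ) T₀, IsVel (A (φ t)) ω (j t) (v t)) ∧
  (∀ t ∈ Icc (0 : ℝ) T₀, ∀ x : E3,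
    IntervalIntegrable (fun s => emb (v s) (φ s x)) volume 0 t ∧
      φ t x = x + ∫ s in (0 : ℝ)..t, emb (v s) (φ s x)) ∧
  ∀ t₀ ∈ Icc (0 : ℝ) T₀,
    Tendsto (fun t => distS 1 (φ t) (φ t₀)) (𝓝[Icc (0 : ℝ) T₀] t₀) (𝓝 0)

/-- `(φ, v)` solves the parametric-yank system
`φ(t) = id + ∫₀ᵗ v(s) ∘ φ(s) ds`, `v(s) = (ω K_V⁻¹ + A_{φ(s)})⁻¹ jm(φ(s))` on `[0,T₀]`. -/
def IsSolutionP {V : Type*} [NormedAddCommGroup V] [InnerProductSpace ℝ V]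
    (emb : V →ₗ[ℝ] (E3 → E3)) (ω : ℝ) (A : DiffId 1 → V →L[ℝ] V →L[ℝ] ℝ)
    (jm : DiffId 1 → V →L[ℝ] ℝ) (T₀ : ℝ) (φ : ℝ → DiffId 1) (v : ℝ → V) : Prop :=
  (∀ t ∈ Icc (0 : ℝ) T₀, IsVel (A (φ t)) ω (jm (φ t)) (v t)) ∧
  (∀ t ∈ Icc (0 : ℝ) T₀, ∀ x : E3,
    IntervalIntegrable (fun s => emb (v s) (φ s x)) volume 0 t ∧
      φ t x = x + ∫ s in (0 : ℝ)..t, emb (v s) (φ s x)) ∧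
  ∀ t₀ ∈ Icc (0 : ℝ) T₀,
    Tendsto (fun t => distS 1 (φ t) (φ t₀)) (𝓝[Icc (0 : ℝ) T₀] t₀) (𝓝 0)

lemma gronwall_int {a : ℝ → ℝ} (ha : Continuous a) {c K T : ℝ} (hK : 0 ≤ K)
    (h : ∀ t ∈ Icc (0:ℝ) T, a t ≤ c + K * ∫ s in (0:ℝ)..t, a s) :
    ∀ t ∈ Icc (0:ℝ) T, a t ≤ c * Real.exp (K * t) := by
  intro t ht
  have hd : ∀ x : ℝ, HasDerivAt (fun t => c + K * ∫ s in (0:ℝ)..t, a s) (K * a x) x := by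
    intro x
    exact ((intervalIntegral.integral_hasDerivAt_right (ha.intervalIntegrable _ _)
      (ha.stronglyMeasurableAtFilter _ _) ha.continuousAt).const_mul K).const_add c
  have := le_gronwallBound_of_liminf_deriv_right_le (f := fun t => c + K * ∫ s in (0:ℝ)..t, a s)
    (f' := fun x => K * a x) (δ := c) (K := K) (ε := 0) (a := 0) (b := T)
    (fun x _ => (hd x).continuousAt.continuousWithinAt)
    (fun x _ r hr => (hd x).hasDerivWithinAt.liminf_right_slope_le hr) (by simp)
    (fun x hx => by
      have := mul_le_mul_of_nonneg_left (h x ⟨hx.1, hx.2.le⟩) hK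
      simpa using this) t ht
  rw [gronwallBound_ε0, sub_zero] at this
  exact (h t ht).trans this

lemma volterra {E : Type*} [NormedAddCommGroup E] [NormedSpace ℝ E] [CompleteSpace E]
    {T K : ℝ} (hT : 0 ≤ T) (hK : 0 ≤ K) (C : ℝ → Set E) (hC : ∀ t, IsClosed (C t))
    (h0 : ∀ t ∈ Icc (0:ℝ) T, (0:E) ∈ C t) (Φ : (ℝ → E) → ℝ → E)
    (hΦ : ∀ u, Continuous u → (∀ t ∈ Icc (0:ℝ) T, u t ∈ C t) →
      ContinuousOn (Φ u) (Icc 0 T) ∧ ∀ t ∈ Icc (0:ℝ) T, Φ u t ∈ C t)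
    (hL : ∀ u w, Continuous u → (∀ t ∈ Icc (0:ℝ) T, u t ∈ C t) →
      Continuous w → (∀ t ∈ Icc (0:ℝ) T, w t ∈ C t) → ∀ t ∈ Icc (0:ℝ) T,
      ‖Φ u t - Φ w t‖ ≤ K * ∫ s in (0:ℝ)..t, ‖u s - w s‖) :
    ∃ u, Continuous u ∧ (∀ t ∈ Icc (0:ℝ) T, u t ∈ C t) ∧ ∀ t ∈ Icc (0:ℝ) T, Φ u t = u t := by
  let S : Set C(Icc (0:ℝ) T, E) := {u | ∀ t : Icc (0:ℝ) T, u t ∈ C t}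
  have hS : IsClosed S := by
    have : S = ⋂ t : Icc (0:ℝ) T, (fun u : C(Icc (0:ℝ) T, E) => u t) ⁻¹' (C t) := by
      ext u; simp [S]
    rw [this]
    exact isClosed_iInter fun t => (hC t).preimage (by fun_prop)
  have : CompleteSpace S := hS.completeSpace_coe
  have : Nonempty S := ⟨⟨0, fun t => h0 t t.2⟩⟩
  let ext : C(Icc (0:ℝ) T, E) → ℝ → E := fun u => IccExtend hT u
  have hext : ∀ u, Continuous (ext u) := fun u => u.continuous.Icc_extend'
  have hextv : ∀ u (t : ℝ) (ht : t ∈ Icc (0:ℝ) T), ext u t = u ⟨t, ht⟩ := fun u t ht =>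
    IccExtend_of_mem hT _ ht
  have hextC : ∀ u : S, ∀ t ∈ Icc (0:ℝ) T, ext u t ∈ C t := fun u t ht => by
    rw [hextv _ t ht]; exact u.2 ⟨t, ht⟩
  let f : S → S := fun u => ⟨⟨fun t => Φ (ext u) t,
    continuousOn_iff_continuous_domRestrict.1 (hΦ _ (hext u) (hextC u)).1⟩,
    fun t => (hΦ _ (hext u) (hextC u)).2 t t.2⟩
  have key : ∀ n : ℕ, ∀ u w : S, ∀ t : Icc (0:ℝ) T,
      ‖(f^[n] u).1 t - (f^[n] w).1 t‖ ≤ (K * t) ^ n / n.factorial * dist u w := by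
    intro n
    induction n with
    | zero =>
      intro u w t
      simp only [Function.iterate_zero, id, pow_zero, Nat.factorial_zero, Nat.cast_one, div_one,
        one_mul]
      rw [← dist_eq_norm]
      exact ContinuousMap.dist_apply_le_dist t
    | succ n ih =>
      intro u w t
      rw [Function.iterate_succ_apply', Function.iterate_succ_apply']
      have h1 := hL _ _ (hext (f^[n] u)) (hextC _) (hext (f^[n] w)) (hextC _) t t.2
      refine h1.trans ?_
      have h2 : ∫ s in (0:ℝ)..t, ‖ext (f^[n] u) s - ext (f^[n] w) s‖ ≤
          ∫ s in (0:ℝ)..t, (K * s) ^ n / n.factorial * dist u w := by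
        apply intervalIntegral.integral_mono_on t.2.1
        · exact ((hext _).sub (hext _)).norm.intervalIntegrable _ _
        · apply Continuous.intervalIntegrable; fun_prop
        · intro s hs
          have hs' : s ∈ Icc (0:ℝ) T := ⟨hs.1, hs.2.trans t.2.2⟩
          rw [hextv _ s hs', hextv _ s hs']
          exact ih u w ⟨s, hs'⟩
      refine (mul_le_mul_of_nonneg_left h2 hK).trans (le_of_eq ?_)
      simp only [mul_pow, div_eq_mul_inv, mul_assoc, mul_left_comm, intervalIntegral.integral_const_mul, intervalIntegral.integral_mul_const, integral_pow]
      rw [Nat.factorial_succ]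
      push_cast
      field_simp
      simp
      ring
  obtain ⟨n, hn⟩ : ∃ n : ℕ, (K * T) ^ n / n.factorial < 1 / 2 :=
    ((FloorSemiring.tendsto_pow_div_factorial_atTop (K * T)).eventually
      (gt_mem_nhds (by norm_num))).exists
  have hc : ContractingWith (1/2) f^[n] := by
    refine ⟨by rw [← NNReal.coe_lt_coe]; norm_num, LipschitzWith.of_dist_le_mul fun u w => ?_⟩
    have : dist (f^[n] u) (f^[n] w) = dist (f^[n] u).1 (f^[n] w).1 := rfl
    rw [this, ContinuousMap.dist_le (by positivity)]
    intro t
    rw [dist_eq_norm]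
    refine (key n u w t).trans ?_
    refine mul_le_mul_of_nonneg_right ?_ dist_nonneg
    refine le_trans ?_ (hn.le.trans (by norm_num))
    have h1 := t.2.1
    have h2 := t.2.2
    gcongr
  have hfix := hc.isFixedPt_fixedPoint_iterate
  set u := hc.fixedPoint f^[n]
  refine ⟨ext u, hext _, hextC u, fun t ht => ?_⟩
  have : (f u).1 ⟨t, ht⟩ = u.1 ⟨t, ht⟩ := by rw [hfix]
  rw [hextv _ t ht, ← this]
  rfl

open scoped ZeroAtInfty

lemma MemC0.le_supDeriv {s : ℕ} {v : E3 → E3} (h : MemC0 s v) {k : ℕ} (hk : k ≤ s) (x : E3) :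
    ‖iteratedFDeriv ℝ k v x‖ ≤ supDeriv k v := by
  have hc : Continuous fun x => ‖iteratedFDeriv ℝ k v x‖ :=
    (h.1.continuous_iteratedFDeriv (by exact_mod_cast hk)).norm
  let f : C₀(E3, ℝ) := ⟨⟨_, hc⟩, h.2 k hk⟩
  refine le_ciSup (f := fun x => ‖iteratedFDeriv ℝ k v x‖) ⟨‖f‖, ?_⟩ x
  rintro _ ⟨y, rfl⟩
  exact (le_abs_self _).trans (f.toBCF.norm_coe_le_norm y)

lemma supDeriv_nonneg (k : ℕ) (v : E3 → E3) : 0 ≤ supDeriv k v :=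
  Real.iSup_nonneg fun _ => norm_nonneg _

lemma supDeriv_le_normS {s k : ℕ} (hk : k ≤ s) (v : E3 → E3) : supDeriv k v ≤ normS s v :=
  Finset.single_le_sum (f := fun k => supDeriv k v) (fun i _ => supDeriv_nonneg i v)
    (by simpa [Nat.lt_succ_iff] using hk)

lemma MemC0.le0 {s : ℕ} {v : E3 → E3} (h : MemC0 s v) (x : E3) : ‖v x‖ ≤ normS s v := by
  have := (h.le_supDeriv (Nat.zero_le s) x).trans (supDeriv_le_normS (Nat.zero_le s) v)
  simpa using this

lemma MemC0.le1 {s : ℕ} {v : E3 → E3} (h : MemC0 s v) (hs : 1 ≤ s) (x : E3) :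
    ‖fderiv ℝ v x‖ ≤ normS s v := by
  have := (h.le_supDeriv hs x).trans (supDeriv_le_normS hs v)
  simpa [norm_iteratedFDeriv_one] using this

lemma MemC0.diff {s : ℕ} {v : E3 → E3} (h : MemC0 s v) (hs : 1 ≤ s) : Differentiable ℝ v :=
  h.1.differentiable (by simp; omega)

lemma MemC0.contf {s : ℕ} {v : E3 → E3} (h : MemC0 s v) (hs : 1 ≤ s) :
    Continuous (fderiv ℝ v) :=
  h.1.continuous_fderiv (by simp; omega)

lemma MemC0.t0 {s : ℕ} {v : E3 → E3} (h : MemC0 s v) : Tendsto v (cocompact E3) (𝓝 0) := by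
  have := h.2 0 (Nat.zero_le s)
  simp only [norm_iteratedFDeriv_zero] at this
  exact tendsto_zero_iff_norm_tendsto_zero.2 this

lemma MemC0.t1 {s : ℕ} {v : E3 → E3} (h : MemC0 s v) (hs : 1 ≤ s) :
    Tendsto (fderiv ℝ v) (cocompact E3) (𝓝 0) := by
  have := h.2 1 hs
  simp only [norm_iteratedFDeriv_one] at this
  exact tendsto_zero_iff_norm_tendsto_zero.2 this

lemma MemC0.lip1 {v : E3 → E3} (h : MemC0 2 v) (x y : E3) :
    ‖fderiv ℝ v x - fderiv ℝ v y‖ ≤ normS 2 v * ‖x - y‖ := by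
  have hd : Differentiable ℝ (fderiv ℝ v) :=
    (h.1.fderiv_right (m := 1) (by norm_num)).differentiable (by simp)
  refine Convex.norm_image_sub_le_of_norm_fderiv_le (s := univ) (fun z _ => hd z) (fun z _ => ?_)
    convex_univ (mem_univ y) (mem_univ x)
  have := (h.le_supDeriv le_rfl z).trans (supDeriv_le_normS le_rfl v)
  rwa [← norm_iteratedFDeriv_fderiv, norm_iteratedFDeriv_one] at this

lemma MemC0.lip0 {s : ℕ} {v : E3 → E3} (h : MemC0 s v) (hs : 1 ≤ s) (x y : E3) :
    ‖v x - v y‖ ≤ normS s v * ‖x - y‖ :=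
  Convex.norm_image_sub_le_of_norm_fderiv_le (s := univ) (fun z _ => h.diff hs z)
    (fun z _ => h.le1 hs z) convex_univ (mem_univ y) (mem_univ x)

/-- Ambient space of pairs (function, derivative). -/
abbrev Amb : Type := C₀(E3, E3) × C₀(E3, E3 →L[ℝ] E3)

instance instAmb1 : NormedAddCommGroup Amb := inferInstance
instance instAmb2 : NormedSpace ℝ Amb := inferInstance
instance instAmb3 : CompleteSpace Amb := inferInstance

/-- The space `C₀¹` as pairs (function, derivative). -/
def XSub : Submodule ℝ Amb where
  carrier := {p | ∀ x, HasFDerivAt p.1 (p.2 x) x}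
  add_mem' := by
    intro a b ha hb x
    exact (ha x).add (hb x)
  zero_mem' := fun x => hasFDerivAt_const _ _
  smul_mem' := by
    intro c a ha x
    exact (ha x).const_smul c

lemma XSub_closed : IsClosed (XSub : Set Amb) := by
  refine isClosed_of_closure_subset fun p hp => ?_
  have hne := mem_closure_iff_comap_neBot.1 hp
  intro x
  have hqp : Tendsto (Subtype.val : XSub → Amb) (comap Subtype.val (𝓝 p)) (𝓝 p) := tendsto_comap
  have h1 : Tendsto (fun q : XSub => q.1.1) (comap Subtype.val (𝓝 p)) (𝓝 p.1) :=
    (continuous_fst.tendsto p).comp hqp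
  have h2 : Tendsto (fun q : XSub => q.1.2) (comap Subtype.val (𝓝 p)) (𝓝 p.2) :=
    (continuous_snd.tendsto p).comp hqp
  have h1' := ZeroAtInftyContinuousMap.tendsto_iff_tendstoUniformly.1 h1
  have h2' := ZeroAtInftyContinuousMap.tendsto_iff_tendstoUniformly.1 h2
  exact @hasFDerivAt_of_tendstoUniformly _ _ _ _ _ _ _ _ _ _ _ _ _ _ _ hne h2' (fun n x => n.2 x) (fun x => h1'.tendsto_at x) x

/-- The Banach space `C₀¹`. -/
def X : Type := XSub

instance instX1 : NormedAddCommGroup X := Submodule.normedAddCommGroup XSub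
instance instX2 : NormedSpace ℝ X := Submodule.normedSpace XSub
instance instX3 : CompleteSpace X := XSub_closed.completeSpace_coe

/-- value of an element of `X` -/
def X.f (u : X) : E3 → E3 := u.1.1
/-- derivative of an element of `X` -/
def X.d (u : X) : E3 → E3 →L[ℝ] E3 := u.1.2

lemma X.hasFDerivAt (u : X) (x : E3) : HasFDerivAt u.f (u.d x) x := u.2 x
lemma X.contf (u : X) : Continuous u.f := u.1.1.continuous
lemma X.contd (u : X) : Continuous u.d := u.1.2.continuous
lemma X.t0 (u : X) : Tendsto u.f (cocompact E3) (𝓝 0) := u.1.1.zero_at_infty'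
lemma X.t1 (u : X) : Tendsto u.d (cocompact E3) (𝓝 0) := u.1.2.zero_at_infty'
@[simp] lemma X.sub_f (u w : X) (x : E3) : (u - w).f x = u.f x - w.f x := rfl
@[simp] lemma X.sub_d (u w : X) (x : E3) : (u - w).d x = u.d x - w.d x := rfl
@[simp] lemma X.add_f (u w : X) (x : E3) : (u + w).f x = u.f x + w.f x := rfl
@[simp] lemma X.add_d (u w : X) (x : E3) : (u + w).d x = u.d x + w.d x := rfl
@[simp] lemma X.smul_f (c : ℝ) (w : X) (x : E3) : (c • w).f x = c • w.f x := rfl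
@[simp] lemma X.smul_d (c : ℝ) (w : X) (x : E3) : (c • w).d x = c • w.d x := rfl
@[simp] lemma X.zero_f (x : E3) : (0 : X).f x = 0 := rfl

lemma X.norm_f_le (u : X) (x : E3) : ‖u.f x‖ ≤ ‖u‖ :=
  (u.1.1.toBCF.norm_coe_le_norm x).trans (le_max_left _ _)
lemma X.norm_d_le (u : X) (x : E3) : ‖u.d x‖ ≤ ‖u‖ :=
  (u.1.2.toBCF.norm_coe_le_norm x).trans (le_max_right _ _)
lemma X.norm_le {u : X} {c : ℝ} (hc : 0 ≤ c) (h0 : ∀ x, ‖u.f x‖ ≤ c) (h1 : ∀ x, ‖u.d x‖ ≤ c) :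
    ‖u‖ ≤ c :=
  max_le ((u.1.1.toBCF.norm_le hc).2 h0) ((u.1.2.toBCF.norm_le hc).2 h1)

lemma X.ext' {u w : X} (h : ∀ x, u.f x = w.f x) : u = w := by
  have h0 : u.f = w.f := funext h
  refine Subtype.ext (Prod.ext (DFunLike.ext _ _ h) (DFunLike.ext _ _ fun x => ?_))
  have h1 := u.hasFDerivAt x
  rw [h0] at h1
  exact h1.unique (w.hasFDerivAt x)

/-- Build an element of `X`. -/
def X.mk' (f : E3 → E3) (d : E3 → E3 →L[ℝ] E3) (h : ∀ x, HasFDerivAt f (d x) x)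
    (hd : Continuous d) (h0 : Tendsto f (cocompact E3) (𝓝 0))
    (h1 : Tendsto d (cocompact E3) (𝓝 0)) : X :=
  ⟨(⟨⟨f, (Differentiable.continuous fun x => (h x).differentiableAt)⟩, h0⟩, ⟨⟨d, hd⟩, h1⟩), h⟩

/-- element of `X` from a `C₀¹` function -/
def toX (f : E3 → E3) (h : MemC0 1 f) : X :=
  X.mk' f (fderiv ℝ f) (fun x => (h.diff le_rfl x).hasFDerivAt) (h.contf le_rfl) h.t0 (h.t1 le_rfl)

lemma X.memC0 (u : X) : MemC0 1 u.f := by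
  have hf : fderiv ℝ u.f = u.d := funext fun x => (u.hasFDerivAt x).fderiv
  refine ⟨?_, fun k hk => ?_⟩
  · have : ContDiff ℝ 1 u.f := contDiff_one_iff_fderiv.2
      ⟨fun x => (u.hasFDerivAt x).differentiableAt, by rw [hf]; exact u.contd⟩
    exact_mod_cast this
  · interval_cases k
    · simp only [norm_iteratedFDeriv_zero]
      exact tendsto_zero_iff_norm_tendsto_zero.1 u.t0
    · simp only [norm_iteratedFDeriv_one, hf]
      exact tendsto_zero_iff_norm_tendsto_zero.1 u.t1

lemma X.fderiv_eq (u : X) (x : E3) : fderiv ℝ u.f x = u.d x := (u.hasFDerivAt x).fderiv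

lemma X.normS_le (u : X) : normS 1 u.f ≤ 2 * ‖u‖ := by
  have h0 : supDeriv 0 u.f ≤ ‖u‖ := ciSup_le fun x => by
    rw [norm_iteratedFDeriv_zero]; exact u.norm_f_le x
  have h1 : supDeriv 1 u.f ≤ ‖u‖ := ciSup_le fun x => by
    rw [norm_iteratedFDeriv_one, X.fderiv_eq]; exact u.norm_d_le x
  have : normS 1 u.f = supDeriv 0 u.f + supDeriv 1 u.f := by
    simp [normS, Finset.sum_range_succ]
  rw [this]; linarith

lemma X.tendsto_add (u : X) : Tendsto (fun x => x + u.f x) (cocompact E3) (cocompact E3) := by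
  refine tendsto_cocompact_cocompact_of_norm fun ε => ⟨ε + ‖u‖, fun x hx => ?_⟩
  have h1 := u.norm_f_le x
  have h2 : ‖x‖ ≤ ‖x + u.f x‖ + ‖u.f x‖ := by
    simpa using norm_sub_le (x + u.f x) (u.f x)
  linarith

/-- `w ∘ (id + u)` as an element of `X`. -/
def compX (w : E3 → E3) (hw : MemC0 2 w) (u : X) : X :=
  X.mk' (fun x => w (x + u.f x))
    (fun x => (fderiv ℝ w (x + u.f x)).comp (ContinuousLinearMap.id ℝ E3 + u.d x))
    (fun x => by
      have h1 : HasFDerivAt (fun x => x + u.f x) (ContinuousLinearMap.id ℝ E3 + u.d x) x :=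
        (hasFDerivAt_id x).add (u.hasFDerivAt x)
      exact ((hw.diff (by norm_num) (x + u.f x)).hasFDerivAt).comp x h1)
    (((hw.contf (by norm_num)).comp (continuous_id.add u.contf)).clm_comp
      (continuous_const.add u.contd))
    (hw.t0.comp u.tendsto_add)
    (by
      refine squeeze_zero_norm (a := fun x => ‖fderiv ℝ w (x + u.f x)‖ * (1 + ‖u‖)) (fun x => ?_) ?_
      · refine (ContinuousLinearMap.opNorm_comp_le _ _).trans ?_
        gcongr
        exact (norm_add_le _ _).trans (add_le_add ContinuousLinearMap.norm_id_le (u.norm_d_le x))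
      · have := ((hw.t1 (by norm_num)).comp u.tendsto_add).norm.mul_const (1 + ‖u‖)
        simpa using this)

lemma compX_f (w : E3 → E3) (hw : MemC0 2 w) (u : X) (x : E3) :
    (compX w hw u).f x = w (x + u.f x) := rfl
lemma compX_d (w : E3 → E3) (hw : MemC0 2 w) (u : X) (x : E3) :
    (compX w hw u).d x =
      (fderiv ℝ w (x + u.f x)).comp (ContinuousLinearMap.id ℝ E3 + u.d x) := rfl

lemma X.norm_id_add (u : X) (x : E3) : ‖ContinuousLinearMap.id ℝ E3 + u.d x‖ ≤ 1 + ‖u‖ :=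
  (norm_add_le _ _).trans (add_le_add ContinuousLinearMap.norm_id_le (u.norm_d_le x))

lemma normS_nonneg (s : ℕ) (w : E3 → E3) : 0 ≤ normS s w :=
  Finset.sum_nonneg fun i _ => supDeriv_nonneg i w

lemma compX_d_le (w : E3 → E3) (hw : MemC0 2 w) (u : X) (x : E3) :
    ‖(compX w hw u).d x‖ ≤ ‖fderiv ℝ w (x + u.f x)‖ * (1 + ‖u‖) := by
  rw [compX_d]
  refine (ContinuousLinearMap.opNorm_comp_le _ _).trans ?_
  gcongr
  exact u.norm_id_add x

lemma compX_norm (w : E3 → E3) (hw : MemC0 2 w) (u : X) :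
    ‖compX w hw u‖ ≤ normS 2 w * (1 + ‖u‖) := by
  have h0 := normS_nonneg 2 w
  refine X.norm_le (by positivity) (fun x => ?_) fun x => ?_
  · rw [compX_f]
    have := hw.le0 (x + u.f x)
    nlinarith [norm_nonneg u]
  · refine (compX_d_le w hw u x).trans ?_
    gcongr
    exact hw.le1 (by norm_num) _

lemma compX_sub_f (w : E3 → E3) (hw : MemC0 2 w) (u u' : X) (x : E3) :
    ‖(compX w hw u).f x - (compX w hw u').f x‖ ≤ normS 2 w * ‖u.f x - u'.f x‖ := by
  rw [compX_f, compX_f]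
  refine (hw.lip0 (by norm_num) _ _).trans (le_of_eq ?_)
  congr 2; abel

lemma compX_sub_d (w : E3 → E3) (hw : MemC0 2 w) (u u' : X) (x : E3) :
    ‖(compX w hw u).d x - (compX w hw u').d x‖ ≤
      normS 2 w * (‖u.f x - u'.f x‖ * (1 + ‖u‖) + ‖u.d x - u'.d x‖) := by
  rw [compX_d, compX_d]
  have h0 := normS_nonneg 2 w
  have e : (fderiv ℝ w (x + u.f x)).comp (ContinuousLinearMap.id ℝ E3 + u.d x) -
      (fderiv ℝ w (x + u'.f x)).comp (ContinuousLinearMap.id ℝ E3 + u'.d x) =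
      (fderiv ℝ w (x + u.f x) - fderiv ℝ w (x + u'.f x)).comp
        (ContinuousLinearMap.id ℝ E3 + u.d x) +
      (fderiv ℝ w (x + u'.f x)).comp (u.d x - u'.d x) := by
    ext1 y
    simp
    abel
  rw [e, mul_add, ← mul_assoc]
  refine (norm_add_le _ _).trans (add_le_add ?_ ?_)
  · refine (ContinuousLinearMap.opNorm_comp_le _ _).trans ?_
    refine mul_le_mul ?_ (u.norm_id_add x) (norm_nonneg _) (by positivity)
    have := hw.lip1 (x + u.f x) (x + u'.f x)
    rwa [add_sub_add_left_eq_sub] at this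
  · refine (ContinuousLinearMap.opNorm_comp_le _ _).trans ?_
    gcongr
    exact hw.le1 (by norm_num) _

lemma compX_sub (w : E3 → E3) (hw : MemC0 2 w) (u u' : X) :
    ‖compX w hw u - compX w hw u'‖ ≤ normS 2 w * (2 + ‖u‖) * ‖u - u'‖ := by
  have h0 := normS_nonneg 2 w
  have hu := norm_nonneg u
  refine X.norm_le (by positivity) (fun x => ?_) fun x => ?_
  · have h1 := compX_sub_f w hw u u' x
    have h2 := (u - u').norm_f_le x
    rw [X.sub_f] at h2 ⊢
    refine h1.trans ?_
    rw [mul_assoc]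
    gcongr
    nlinarith [norm_nonneg (u - u')]
  · have h1 := compX_sub_d w hw u u' x
    have h2 := (u - u').norm_f_le x
    have h3 := (u - u').norm_d_le x
    rw [X.sub_f] at h2
    rw [X.sub_d] at h3 ⊢
    refine h1.trans ?_
    rw [mul_assoc]
    gcongr
    nlinarith [norm_nonneg (u - u')]

section flows
variable {V : Type*} [NormedAddCommGroup V] [InnerProductSpace ℝ V]

/-- `emb v ∘ (id + u)` -/
def compV (emb : V →ₗ[ℝ] (E3 → E3)) (hC0 : ∀ u : V, MemC0 2 (emb u)) (v : V) (u : X) : X :=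
  compX (emb v) (hC0 v) u

variable (emb : V →ₗ[ℝ] (E3 → E3)) (cV : ℝ) (hcV : 0 < cV)
    (hC0 : ∀ u : V, MemC0 2 (emb u)) (hB : ∀ u : V, normS 2 (emb u) ≤ cV * ‖u‖)

lemma compV_f (v : V) (u : X) (x : E3) : (compV emb hC0 v u).f x = emb v (x + u.f x) := rfl

include hB in
lemma compV_norm (v : V) (u : X) : ‖compV emb hC0 v u‖ ≤ cV * ‖v‖ * (1 + ‖u‖) := by
  refine (compX_norm _ _ _).trans ?_
  have := hB v
  gcongr

include hB in
lemma compV_sub (v : V) (u u' : X) :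
    ‖compV emb hC0 v u - compV emb hC0 v u'‖ ≤ cV * ‖v‖ * (2 + ‖u‖) * ‖u - u'‖ := by
  refine (compX_sub _ _ _ _).trans ?_
  have := hB v
  gcongr

lemma compV_sub_v (v v' : V) (u : X) :
    compV emb hC0 v u - compV emb hC0 v' u = compV emb hC0 (v - v') u := by
  apply X.ext'
  intro x
  rw [X.sub_f]
  simp [compV_f]

include hB in
lemma compV_cont {v : ℝ → V} {u : ℝ → X} (hv : Continuous v) (hu : Continuous u) :
    Continuous fun t => compV emb hC0 (v t) (u t) := by
  rw [continuous_iff_continuousAt]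
  intro t₀
  rw [ContinuousAt, tendsto_iff_norm_sub_tendsto_zero]
  have hg : Continuous fun t => cV * ‖v t - v t₀‖ * (1 + ‖u t‖) +
      cV * ‖v t₀‖ * (2 + ‖u t‖) * ‖u t - u t₀‖ := by fun_prop
  have hg0 := hg.tendsto t₀
  simp only [sub_self, norm_zero, mul_zero, zero_mul, add_zero] at hg0
  refine squeeze_zero (fun _ => norm_nonneg _) (fun t => ?_) hg0
  have e : compV emb hC0 (v t) (u t) - compV emb hC0 (v t₀) (u t₀) =
      compV emb hC0 (v t - v t₀) (u t) +
      (compV emb hC0 (v t₀) (u t) - compV emb hC0 (v t₀) (u t₀)) := by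
    rw [← compV_sub_v]; abel
  rw [e]
  exact (norm_add_le _ _).trans (add_le_add (compV_norm emb cV hC0 hB _ _)
    (compV_sub emb cV hC0 hB _ _ _))

/-- flow equation in `X` -/
def IsFlow (v : ℝ → V) (T : ℝ) (u : ℝ → X) : Prop :=
  Continuous u ∧ ∀ t ∈ Icc (0:ℝ) T, u t = ∫ s in (0:ℝ)..t, compV emb hC0 (v s) (u s)

include hcV hB in
lemma exists_flow {v : ℝ → V} (hv : Continuous v) {T r : ℝ} (hT : 0 ≤ T) (hr0 : 0 ≤ r)
    (hr : ∀ t ∈ Icc (0:ℝ) T, ‖v t‖ ≤ r) :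
    ∃ u, IsFlow emb hC0 v T u ∧ ∀ t ∈ Icc (0:ℝ) T, ‖u t‖ ≤ Real.exp (cV * r * t) - 1 := by
  set R := cV * r with hR
  have hR0 : 0 ≤ R := by positivity
  have hcl : ∀ s ∈ Icc (0:ℝ) T, cV * ‖v s‖ ≤ R := fun s hs =>
    mul_le_mul_of_nonneg_left (hr s hs) hcV.le
  obtain ⟨u, hu, hub, hue⟩ := volterra (E := X) (T := T) (K := R * (2 + Real.exp (R * T))) hT
    (by positivity) (fun t => Metric.closedBall 0 (Real.exp (R * t) - 1))
    (fun t => Metric.isClosed_closedBall)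
    (fun t ht => by
      have : 1 ≤ Real.exp (R * t) := Real.one_le_exp (mul_nonneg hR0 ht.1)
      simpa using this)
    (fun u t => ∫ s in (0:ℝ)..t, compV emb hC0 (v s) (u s))
    (fun u hu hub => by
      have hc := compV_cont emb cV hC0 hB hv hu
      refine ⟨(intervalIntegral.continuous_primitive
        (fun a b => hc.intervalIntegrable a b) 0).continuousOn, fun t ht => ?_⟩
      rw [mem_closedBall_zero_iff]
      have hi : ∫ s in (0:ℝ)..t, R * Real.exp (R * s) = Real.exp (R * t) - 1 := by
        have hd : ∀ s ∈ uIcc 0 t, HasDerivAt (fun s => Real.exp (R * s)) (R * Real.exp (R * s)) s := by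
          intro s _
          have := ((hasDerivAt_id s).const_mul R).exp
          simpa [mul_comm] using this
        rw [intervalIntegral.integral_eq_sub_of_hasDerivAt hd
          (Continuous.intervalIntegrable (by fun_prop) _ _)]
        simp
      rw [← hi]
      refine intervalIntegral.norm_integral_le_of_norm_le ht.1 (ae_of_all _ fun s hs => ?_)
        (Continuous.intervalIntegrable (by fun_prop) _ _)
      have hs' : s ∈ Icc (0:ℝ) T := ⟨hs.1.le, hs.2.trans ht.2⟩
      have h1 := hub s hs'
      rw [mem_closedBall_zero_iff] at h1
      refine (compV_norm emb cV hC0 hB _ _).trans ?_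
      refine mul_le_mul (hcl s hs') (by linarith) (by positivity) hR0)
    (fun u w hu hub hw hwb t ht => by
      have hcu := compV_cont emb cV hC0 hB hv hu
      have hcw := compV_cont emb cV hC0 hB hv hw
      rw [← intervalIntegral.integral_sub (hcu.intervalIntegrable _ _)
        (hcw.intervalIntegrable _ _), ← intervalIntegral.integral_const_mul]
      refine intervalIntegral.norm_integral_le_of_norm_le ht.1 (ae_of_all _ fun s hs => ?_)
        (Continuous.intervalIntegrable (by fun_prop) _ _)
      have hs' : s ∈ Icc (0:ℝ) T := ⟨hs.1.le, hs.2.trans ht.2⟩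
      have h1 := hub s hs'
      rw [mem_closedBall_zero_iff] at h1
      have h2 : Real.exp (R * s) ≤ Real.exp (R * T) :=
        Real.exp_le_exp.2 (mul_le_mul_of_nonneg_left hs'.2 hR0)
      refine (compV_sub emb cV hC0 hB _ _ _).trans ?_
      refine mul_le_mul_of_nonneg_right ?_ (norm_nonneg _)
      exact mul_le_mul (hcl s hs') (by linarith) (by positivity) hR0)
  refine ⟨u, ⟨hu, fun t ht => (hue t ht).symm⟩, fun t ht => ?_⟩
  simpa using hub t ht

include hcV hB in
lemma flow_lip {v v' : ℝ → V} (hv : Continuous v) (hv' : Continuous v') {T r B : ℝ}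
    (hr0 : 0 ≤ r) (hB0 : 0 ≤ B)
    (hr : ∀ t ∈ Icc (0:ℝ) T, ‖v t‖ ≤ r) {u u' : ℝ → X}
    (hu : IsFlow emb hC0 v T u) (hu' : IsFlow emb hC0 v' T u')
    (hub : ∀ t ∈ Icc (0:ℝ) T, ‖u t‖ ≤ B) (hub' : ∀ t ∈ Icc (0:ℝ) T, ‖u' t‖ ≤ B) :
    ∀ t ∈ Icc (0:ℝ) T, ‖u t - u' t‖ ≤
      cV * (1 + B) * Real.exp (cV * r * (2 + B) * T) * ∫ s in (0:ℝ)..t, ‖v s - v' s‖ := by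
  intro t ht
  set I := ∫ s in (0:ℝ)..t, ‖v s - v' s‖ with hI
  have hI0 : 0 ≤ I := intervalIntegral.integral_nonneg ht.1 fun _ _ => norm_nonneg _
  have hcu := compV_cont emb cV hC0 hB hv hu.1
  have hcu' := compV_cont emb cV hC0 hB hv' hu'.1
  have hn : Continuous fun s => ‖u s - u' s‖ := (hu.1.sub hu'.1).norm
  have hvv : Continuous fun s => ‖v s - v' s‖ := (hv.sub hv').norm
  have := gronwall_int hn (c := cV * (1 + B) * I) (K := cV * r * (2 + B)) (T := t)
    (by positivity) (fun s hs => by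
      have hs' : s ∈ Icc (0:ℝ) T := ⟨hs.1, hs.2.trans ht.2⟩
      rw [hu.2 s hs', hu'.2 s hs', ← intervalIntegral.integral_sub (hcu.intervalIntegrable _ _)
        (hcu'.intervalIntegrable _ _)]
      have h1 : cV * (1 + B) * ∫ q in (0:ℝ)..s, ‖v q - v' q‖ ≤ cV * (1 + B) * I := by
        gcongr
        exact intervalIntegral.integral_mono_interval le_rfl hs.1 hs.2
          (ae_of_all _ fun _ => norm_nonneg _) (hvv.intervalIntegrable _ _)
      refine le_trans ?_ (add_le_add_left h1 _)
      rw [← intervalIntegral.integral_const_mul, ← intervalIntegral.integral_const_mul,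
        ← intervalIntegral.integral_add (Continuous.intervalIntegrable (by fun_prop) _ _)
        (Continuous.intervalIntegrable (by fun_prop) _ _)]
      refine intervalIntegral.norm_integral_le_of_norm_le hs.1 (ae_of_all _ fun q hq => ?_)
        (Continuous.intervalIntegrable (by fun_prop) _ _)
      have hq' : q ∈ Icc (0:ℝ) T := ⟨hq.1.le, hq.2.trans hs'.2⟩
      have e : compV emb hC0 (v q) (u q) - compV emb hC0 (v' q) (u' q) =
          compV emb hC0 (v q - v' q) (u' q) +
          (compV emb hC0 (v q) (u q) - compV emb hC0 (v q) (u' q)) := by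
        rw [← compV_sub_v]; abel
      rw [e]
      refine (norm_add_le _ _).trans (add_le_add ?_ ?_)
      · refine (compV_norm emb cV hC0 hB _ _).trans ?_
        have := hub' q hq'
        calc cV * ‖v q - v' q‖ * (1 + ‖u' q‖) ≤ cV * ‖v q - v' q‖ * (1 + B) := by gcongr
          _ = _ := by ring
      · refine (compV_sub emb cV hC0 hB _ _ _).trans ?_
        have h3 := hub q hq'
        have h4 := hr q hq'
        gcongr) t ⟨ht.1, le_rfl⟩
  refine this.trans ?_
  calc cV * (1 + B) * I * Real.exp (cV * r * (2 + B) * t)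
      ≤ cV * (1 + B) * I * Real.exp (cV * r * (2 + B) * T) := by
        gcongr
        exact ht.2
    _ = _ := by ring

/-- evaluation at a point -/
def evalX (x : E3) : X →L[ℝ] E3 :=
  LinearMap.mkContinuous (⟨⟨fun u => u.f x, fun _ _ => rfl⟩, fun _ _ => rfl⟩ : X →ₗ[ℝ] E3) 1
    (fun u => by rw [one_mul]; exact u.norm_f_le x)

include hB in
lemma flow_eval {v : ℝ → V} (hv : Continuous v) {T : ℝ} {u : ℝ → X}
    (hu : IsFlow emb hC0 v T u) (x : E3) : ∀ t ∈ Icc (0:ℝ) T,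
    (u t).f x = ∫ s in (0:ℝ)..t, emb (v s) (x + (u s).f x) := by
  intro t ht
  have hc := compV_cont emb cV hC0 hB hv hu.1
  have := (evalX x).intervalIntegral_comp_comm (hc.intervalIntegrable (μ := volume) 0 t)
  rw [← hu.2 t ht] at this
  exact this.symm

include hC0 hB in
lemma emb_lip (v : V) (x y : E3) : ‖emb v x - emb v y‖ ≤ cV * ‖v‖ * ‖x - y‖ :=
  ((hC0 v).lip0 (by norm_num) x y).trans (mul_le_mul_of_nonneg_right (hB v) (norm_nonneg _))

include hC0 hB in
lemma emb_cont {v : ℝ → V} {y : ℝ → E3} (hv : Continuous v) (hy : Continuous y) :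
    Continuous fun t => emb (v t) (y t) := by
  rw [continuous_iff_continuousAt]
  intro t₀
  rw [ContinuousAt, tendsto_iff_norm_sub_tendsto_zero]
  have hg : Continuous fun t => cV * ‖v t - v t₀‖ + cV * ‖v t₀‖ * ‖y t - y t₀‖ := by fun_prop
  have hg0 := hg.tendsto t₀
  simp only [sub_self, norm_zero, mul_zero, add_zero] at hg0
  refine squeeze_zero (fun _ => norm_nonneg _) (fun t => ?_) hg0
  have e : emb (v t) (y t) - emb (v t₀) (y t₀) = emb (v t - v t₀) (y t) +
      (emb (v t₀) (y t) - emb (v t₀) (y t₀)) := by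
    simp
  rw [e]
  exact (norm_add_le _ _).trans (add_le_add (((hC0 _).le0 _).trans (hB _))
    (emb_lip emb cV hC0 hB _ _ _))

include hcV hC0 hB in
lemma point_unique {v : ℝ → V} (hv : Continuous v) {T r : ℝ} (hr0 : 0 ≤ r)
    (hr : ∀ t ∈ Icc (0:ℝ) T, ‖v t‖ ≤ r) {y z : ℝ → E3} (hy : Continuous y) (hz : Continuous z)
    (p : E3) (hye : ∀ t ∈ Icc (0:ℝ) T, y t = p + ∫ s in (0:ℝ)..t, emb (v s) (y s))
    (hze : ∀ t ∈ Icc (0:ℝ) T, z t = p + ∫ s in (0:ℝ)..t, emb (v s) (z s)) :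
    ∀ t ∈ Icc (0:ℝ) T, y t = z t := by
  intro t ht
  have hcy := emb_cont emb cV hC0 hB hv hy
  have hcz := emb_cont emb cV hC0 hB hv hz
  have hn : Continuous fun s => ‖y s - z s‖ := (hy.sub hz).norm
  have := gronwall_int hn (c := 0) (K := cV * r) (T := T)
    (by positivity) (fun s hs => by
      rw [zero_add]
      rw [hye s hs, hze s hs, add_sub_add_left_eq_sub,
        ← intervalIntegral.integral_sub (hcy.intervalIntegrable _ _)
        (hcz.intervalIntegrable _ _), ← intervalIntegral.integral_const_mul]
      refine intervalIntegral.norm_integral_le_of_norm_le hs.1 (ae_of_all _ fun q hq => ?_)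
        (Continuous.intervalIntegrable (by fun_prop) _ _)
      have hq' : q ∈ Icc (0:ℝ) T := ⟨hq.1.le, hq.2.trans hs.2⟩
      refine (emb_lip emb cV hC0 hB _ _ _).trans ?_
      have h4 := hr q hq'
      gcongr) t ht
  rw [zero_mul] at this
  exact sub_eq_zero.1 (norm_le_zero_iff.1 this)

lemma X.cont_eval {u : ℝ → X} (hu : Continuous u) (x : E3) : Continuous fun t => (u t).f x :=
  (evalX x).continuous.comp hu

include hcV hB in
lemma flow_inv {v : ℝ → V} (hv : Continuous v) {t r : ℝ} (ht : 0 ≤ t) (hr0 : 0 ≤ r)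
    (hr : ∀ s ∈ Icc (0:ℝ) t, ‖v s‖ ≤ r) {u w : ℝ → X}
    (hu : IsFlow emb hC0 v t u) (hw : IsFlow emb hC0 (fun s => -v (t - s)) t w) (x : E3) :
    (x + (u t).f x) + (w t).f (x + (u t).f x) = x := by
  have hv' : Continuous fun s => -v (t - s) := by fun_prop
  have key := point_unique emb cV hcV hC0 hB hv' hr0 (T := t) (r := r)
    (fun s hs => by
      rw [norm_neg]; exact hr _ ⟨by linarith [hs.2], by linarith [hs.1]⟩)
    (y := fun s => (x + (u t).f x) + (w s).f (x + (u t).f x))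
    (z := fun s => x + (u (t - s)).f x)
    (continuous_const.add (X.cont_eval hw.1 _))
    (continuous_const.add ((X.cont_eval hu.1 x).comp (continuous_const.sub continuous_id)))
    (x + (u t).f x)
    (fun s hs => by
      rw [flow_eval emb cV hC0 hB hv' hw _ s hs])
    (fun s hs => by
      have hg : Continuous fun q => emb (v q) (x + (u q).f x) :=
        emb_cont emb cV hC0 hB hv (continuous_const.add (X.cont_eval hu.1 x))
      have e : ∀ q, emb (-v (t - q)) (x + (u (t - q)).f x) =
          -(fun q => emb (v q) (x + (u q).f x)) (t - q) := by
        intro q; simp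
      simp only [e]
      rw [intervalIntegral.integral_neg,
        intervalIntegral.integral_comp_sub_left (fun q => emb (v q) (x + (u q).f x)) t, sub_zero,
        flow_eval emb cV hC0 hB hv hu x t ⟨ht, le_rfl⟩,
        flow_eval emb cV hC0 hB hv hu x (t - s) ⟨by linarith [hs.2], by linarith [hs.1]⟩,
        ← intervalIntegral.integral_add_adjacent_intervals (hg.intervalIntegrable 0 (t - s))
          (hg.intervalIntegrable (t - s) t)]
      abel)
    t ⟨ht, le_rfl⟩
  have h0 : u 0 = 0 := by
    rw [hu.2 0 ⟨le_rfl, ht⟩]; simp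
  simpa [h0] using key
end flows

lemma normS_one_le {f : E3 → E3} {a b : ℝ} (h0 : ∀ x, ‖f x‖ ≤ a) (h1 : ∀ x, ‖fderiv ℝ f x‖ ≤ b) :
    normS 1 f ≤ a + b := by
  have h0 : supDeriv 0 f ≤ a := ciSup_le fun x => by
    rw [norm_iteratedFDeriv_zero]; exact h0 x
  have h1 : supDeriv 1 f ≤ b := ciSup_le fun x => by
    rw [norm_iteratedFDeriv_one]; exact h1 x
  have : normS 1 f = supDeriv 0 f + supDeriv 1 f := by
    simp [normS, Finset.sum_range_succ]
  rw [this]; linarith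

lemma DiffId.diff (φ : DiffId 1) : Differentiable ℝ φ.toFun := by
  have h := (φ.memC0.diff le_rfl).add differentiable_id
  have e : (fun x => φ.toFun x - x) + id = φ.toFun := by ext1 x; simp
  rwa [e] at h

lemma DiffId.diff_inv (φ : DiffId 1) : Differentiable ℝ φ.invFun := by
  have h := (φ.memC0_inv.diff le_rfl).add differentiable_id
  have e : (fun x => φ.invFun x - x) + id = φ.invFun := by ext1 x; simp
  rwa [e] at h

lemma fderiv_sub_self {f : E3 → E3} (hf : Differentiable ℝ f) (x : E3) :
    fderiv ℝ (fun x => f x - x) x = fderiv ℝ f x - ContinuousLinearMap.id ℝ E3 :=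
  ((hf x).hasFDerivAt.sub (hasFDerivAt_id x)).fderiv

lemma memC0_sub (φ ψ : DiffId 1) : MemC0 1 fun x => φ x - ψ x := by
  have := (toX _ φ.memC0 - toX _ ψ.memC0).memC0
  have e : (toX _ φ.memC0 - toX _ ψ.memC0).f = fun x => φ x - ψ x := by
    ext1 x
    rw [X.sub_f]
    change (φ x - x) - (ψ x - x) = _
    abel
  rwa [e] at this

lemma fderiv_sub_diff (φ ψ : DiffId 1) (x : E3) :
    fderiv ℝ (fun x => φ x - ψ x) x = fderiv ℝ φ.toFun x - fderiv ℝ ψ.toFun x :=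
  ((φ.diff x).hasFDerivAt.sub (ψ.diff x).hasFDerivAt).fderiv

lemma normSOn_le_distS (M : Set E3) (φ ψ : DiffId 1) :
    normSOn M (fun x => φ x - ψ x) ≤ 2 * distS 1 φ ψ := by
  have h := memC0_sub φ ψ
  have h0 := normS_nonneg 1 fun x => φ x - ψ x
  have h1 : (⨆ x : M, ‖φ (x : E3) - ψ (x : E3)‖) ≤ distS 1 φ ψ :=
    Real.iSup_le (fun x => h.le0 _) h0
  have h2 : (⨆ x : M, ‖fderiv ℝ (fun x => φ x - ψ x) (x : E3)‖) ≤ distS 1 φ ψ :=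
    Real.iSup_le (fun x => h.le1 le_rfl _) h0
  unfold normSOn
  linarith

lemma normSOn_nonneg (M : Set E3) (f : E3 → E3) : 0 ≤ normSOn M f :=
  add_nonneg (Real.iSup_nonneg fun _ => norm_nonneg _) (Real.iSup_nonneg fun _ => norm_nonneg _)

lemma fderiv_inv_comp {f g : E3 → E3} (hf : Differentiable ℝ f) (hg : Differentiable ℝ g)
    (h : Function.LeftInverse g f) (x : E3) (k : E3) :
    fderiv ℝ g (f x) (fderiv ℝ f x k) = k := by
  have h1 := (hg (f x)).hasFDerivAt.comp x (hf x).hasFDerivAt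
  have e : g ∘ f = id := funext h
  rw [e] at h1
  have := h1.unique (hasFDerivAt_id x)
  have := congrArg (fun L => L k) this
  simpa using this

lemma Sgamma_local (φ₀ : DiffId 1) : ∃ ε > 0, ∃ γ > 0, ∀ φ : DiffId 1, distS 1 φ φ₀ ≤ ε →
    φ ∈ Sgamma γ := by
  obtain ⟨a, ha⟩ : ∃ a, a = normS 1 (fun x => φ₀ x - x) := ⟨_, rfl⟩
  obtain ⟨b, hb⟩ : ∃ b, b = normS 1 (fun x => φ₀.invFun x - x) := ⟨_, rfl⟩
  have ha0 : 0 ≤ a := ha ▸ normS_nonneg _ _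
  have hb0 : 0 ≤ b := hb ▸ normS_nonneg _ _
  obtain ⟨ε, hε0, h5⟩ : ∃ ε > 0, (1 + b) * ε = 1 / 2 :=
    ⟨1 / (2 * (1 + b)), by positivity, by field_simp⟩
  refine ⟨ε, hε0, 2 * (a + ε) + (2 * (1 + b) + 1), by positivity, fun φ hφ => ?_⟩
  have hm := memC0_sub φ φ₀
  have hφ' : normS 1 (fun x => φ x - φ₀ x) ≤ ε := hφ
  have hd0 : ∀ x, ‖φ x - φ₀ x‖ ≤ ε := fun x => le_trans (hm.le0 x) hφ'
  have hd1 : ∀ x, ‖fderiv ℝ φ.toFun x - fderiv ℝ φ₀.toFun x‖ ≤ ε := fun x => by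
    rw [← fderiv_sub_diff]; exact le_trans (hm.le1 le_rfl x) hφ'
  have hB : ∀ y, ‖fderiv ℝ φ₀.invFun y‖ ≤ 1 + b := fun y => by
    have h1 := φ₀.memC0_inv.le1 le_rfl y
    rw [← hb] at h1
    rw [fderiv_sub_self φ₀.diff_inv] at h1
    have h2 := norm_add_le (fderiv ℝ φ₀.invFun y - ContinuousLinearMap.id ℝ E3)
      (ContinuousLinearMap.id ℝ E3)
    rw [sub_add_cancel] at h2
    have h3 : ‖ContinuousLinearMap.id ℝ E3‖ ≤ 1 := ContinuousLinearMap.norm_id_le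
    linarith
  have hx : ∀ x, ‖φ x - x‖ ≤ a + ε := fun x => by
    have h1 := φ₀.memC0.le0 x
    rw [← ha] at h1
    have h2 := norm_add_le (φ x - φ₀ x) (φ₀ x - x)
    rw [sub_add_sub_cancel] at h2
    linarith [hd0 x]
  constructor
  · have := normS_one_le (f := fun x => φ x - x) (a := a + ε) (b := a + ε) hx (fun x => by
      have h1 := φ₀.memC0.le1 le_rfl x
      rw [← ha] at h1
      rw [fderiv_sub_self φ₀.diff] at h1
      rw [fderiv_sub_self φ.diff]
      have h2 := norm_add_le (fderiv ℝ φ.toFun x - fderiv ℝ φ₀.toFun x)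
        (fderiv ℝ φ₀.toFun x - ContinuousLinearMap.id ℝ E3)
      rw [sub_add_sub_cancel] at h2
      linarith [hd1 x])
    linarith
  · have := normS_one_le (f := fun x => φ.invFun x - x) (a := a + ε) (b := 2 * (1 + b) + 1)
      (fun y => by
        have h1 := hx (φ.invFun y)
        have h2 : φ (φ.invFun y) = y := φ.right_inv y
        rw [h2, norm_sub_rev] at h1
        exact h1)
      (fun y => by
        rw [fderiv_sub_self φ.diff_inv]
        refine (norm_sub_le _ _).trans (add_le_add ?_ ContinuousLinearMap.norm_id_le)
        refine ContinuousLinearMap.opNorm_le_bound _ (by positivity) fun h => ?_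
        set k := fderiv ℝ φ.invFun y h with hk
        set x := φ.invFun y with hxd
        have e1 : fderiv ℝ φ.toFun x k = h :=
          fderiv_inv_comp φ.diff_inv φ.diff φ.right_inv y h
        have e2 := fderiv_inv_comp φ₀.diff φ₀.diff_inv φ₀.left_inv x k
        have h1 : ‖k‖ ≤ (1 + b) * ‖fderiv ℝ φ₀.toFun x k‖ := by
          conv_lhs => rw [← e2]
          exact ContinuousLinearMap.le_of_opNorm_le _ (hB _) _
        have h2 : ‖fderiv ℝ φ₀.toFun x k‖ ≤ ‖h‖ + ε * ‖k‖ := by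
          have h3 := ContinuousLinearMap.le_of_opNorm_le _ (hd1 x) k
          have h4 : fderiv ℝ φ₀.toFun x k =
              h - (fderiv ℝ φ.toFun x - fderiv ℝ φ₀.toFun x) k := by
            rw [sub_apply, e1]; abel
          rw [h4]
          exact (norm_sub_le _ _).trans (by linarith)
        have h6 := mul_le_mul_of_nonneg_left h2 (by positivity : 0 ≤ 1 + b)
        have h7 : (1 + b) * (‖h‖ + ε * ‖k‖) = (1 + b) * ‖h‖ + (1 / 2) * ‖k‖ := by
          rw [← h5]; ring
        linarith)
    linarith

/-- diffeomorphism from displacement fields -/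
def mkDiff (u w : X) (h1 : ∀ x, (x + u.f x) + w.f (x + u.f x) = x)
    (h2 : ∀ x, (x + w.f x) + u.f (x + w.f x) = x) : DiffId 1 where
  toFun x := x + u.f x
  invFun x := x + w.f x
  left_inv := h1
  right_inv := h2
  memC0 := by simpa using u.memC0
  memC0_inv := by simpa using w.memC0

section vel
variable {V : Type*} [NormedAddCommGroup V] [InnerProductSpace ℝ V]

lemma exists_vel [CompleteSpace V] (B : V →L[ℝ] V →L[ℝ] ℝ) (hp : ∀ u, 0 ≤ B u u) {ω : ℝ}
    (hω : 0 < ω) (j : V →L[ℝ] ℝ) : ∃ v, IsVel B ω j v := by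
  let I : V →L[ℝ] V →L[ℝ] ℝ := @innerSL ℝ V _ _ _
  have hI : ∀ u w, I u w = ⟪u, w⟫ := fun u w => rfl
  let B' : V →L[ℝ] V →L[ℝ] ℝ := ω • I + B
  have hB' : ∀ u w, B' u w = ω * ⟪u, w⟫ + B u w := fun u w => by
    change ω • (I u w) + B u w = _
    rw [hI]; rfl
  have hc : IsCoercive B' := ⟨ω, hω, fun u => by
    rw [hB', real_inner_self_eq_norm_mul_norm]
    have := hp u
    nlinarith⟩
  let f := (InnerProductSpace.toDual ℝ V).symm j
  refine ⟨hc.continuousLinearEquivOfBilin.symm f, fun w => ?_⟩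
  rw [← hB', ← hc.continuousLinearEquivOfBilin_apply, ContinuousLinearEquiv.apply_symm_apply]
  exact InnerProductSpace.toDual_symm_apply

lemma vel_norm {B : V →L[ℝ] V →L[ℝ] ℝ} (hp : ∀ u, 0 ≤ B u u) {ω : ℝ}
    (hω : 0 < ω) {j : V →L[ℝ] ℝ} {v : V} (h : IsVel B ω j v) : ‖v‖ ≤ ‖j‖ / ω := by
  have h1 := h v
  rw [real_inner_self_eq_norm_mul_norm] at h1
  have h2 : j v ≤ ‖j‖ * ‖v‖ := (le_abs_self _).trans (j.le_opNorm v)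
  have h3 := hp v
  rw [le_div_iff₀ hω]
  rcases (norm_nonneg v).eq_or_lt with h0 | h0
  · rw [← h0]; simp
  · have : (‖v‖ * ω) * ‖v‖ ≤ ‖j‖ * ‖v‖ := by nlinarith
    exact le_of_mul_le_mul_right this h0

lemma vel_diff {B B' : V →L[ℝ] V →L[ℝ] ℝ} (hp : ∀ u, 0 ≤ B u u) {ω : ℝ}
    (hω : 0 < ω) {j j' : V →L[ℝ] ℝ} {v v' : V} (h : IsVel B ω j v) (h' : IsVel B' ω j' v') :
    ‖v - v'‖ ≤ (‖j - j'‖ + ‖B - B'‖ * ‖v'‖) / ω := by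
  have h1 : IsVel B ω (j - j' - (B - B') v') (v - v') := by
    intro w
    have e1 := h w
    have e2 := h' w
    simp only [inner_sub_left, map_sub, sub_apply]
    linarith
  refine (vel_norm hp hω h1).trans ?_
  gcongr
  exact (norm_sub_le _ _).trans (add_le_add_right ((B - B').le_opNorm v') _)

lemma vel_weak [CompleteSpace V] {B : V →L[ℝ] V →L[ℝ] ℝ} (hs : ∀ u w, B u w = B w u)
    (hp : ∀ u, 0 ≤ B u u) {ω : ℝ} (hω : 0 < ω) {jn : ℕ → V →L[ℝ] ℝ} {j : V →L[ℝ] ℝ}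
    {vn : ℕ → V} {v : V} (hn : ∀ n, IsVel B ω (jn n) (vn n)) (h : IsVel B ω j v)
    (hj : ∀ w, Tendsto (fun n => jn n w) atTop (𝓝 (j w))) (l : V →L[ℝ] ℝ) :
    Tendsto (fun n => l (vn n - v)) atTop (𝓝 0) := by
  obtain ⟨z, hz⟩ := exists_vel B hp hω l
  have e : ∀ n, l (vn n - v) = jn n z - j z := fun n => by
    rw [← hz, real_inner_comm, hs, ← hn n, ← h z]
    simp only [inner_sub_left, map_sub, sub_apply]
    ring
  simp only [e]
  simpa using (hj z).sub_const (j z)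
end vel

section restr

lemma q_le {M : Set E3} {u : X} {c d : ℝ} (hc : 0 ≤ c) (hd : 0 ≤ d) (h0 : ∀ x ∈ M, ‖u.f x‖ ≤ c)
    (h1 : ∀ x ∈ M, ‖u.d x‖ ≤ d) : normSOn M u.f ≤ c + d := by
  refine add_le_add (Real.iSup_le (fun x => h0 x x.2) hc) (Real.iSup_le (fun x => ?_) hd)
  rw [X.fderiv_eq]; exact h1 x x.2

lemma q_le_norm (M : Set E3) (u : X) : normSOn M u.f ≤ 2 * ‖u‖ := by
  have := q_le (M := M) (norm_nonneg u) (norm_nonneg u) (fun x _ => u.norm_f_le x)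
    (fun x _ => u.norm_d_le x)
  linarith

lemma q_fd {M : Set E3} (u : X) {x : E3} (hx : x ∈ M) : ‖u.f x‖ + ‖u.d x‖ ≤ normSOn M u.f := by
  refine add_le_add ?_ ?_
  · exact le_ciSup (f := fun x : M => ‖u.f x‖)
      ⟨‖u‖, by rintro _ ⟨y, rfl⟩; exact u.norm_f_le y⟩ ⟨x, hx⟩
  · rw [← X.fderiv_eq]
    exact le_ciSup (f := fun x : M => ‖fderiv ℝ u.f x‖)
      ⟨‖u‖, by rintro _ ⟨y, rfl⟩; change ‖fderiv ℝ u.f y‖ ≤ _; rw [X.fderiv_eq]; exact u.norm_d_le y⟩ ⟨x, hx⟩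

lemma q_f {M : Set E3} (u : X) {x : E3} (hx : x ∈ M) : ‖u.f x‖ ≤ normSOn M u.f :=
  (le_add_of_nonneg_right (norm_nonneg _)).trans (q_fd u hx)

lemma q_d {M : Set E3} (u : X) {x : E3} (hx : x ∈ M) : ‖u.d x‖ ≤ normSOn M u.f :=
  (le_add_of_nonneg_left (norm_nonneg _)).trans (q_fd u hx)

lemma q_sub_le (M : Set E3) (u w : X) : normSOn M u.f - normSOn M w.f ≤ 2 * ‖u - w‖ := by
  have hb0 : BddAbove (range fun x : M => ‖w.f x‖) :=
    ⟨‖w‖, by rintro _ ⟨y, rfl⟩; exact w.norm_f_le y⟩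
  have hb1 : BddAbove (range fun x : M => ‖w.d x‖) :=
    ⟨‖w‖, by rintro _ ⟨y, rfl⟩; exact w.norm_d_le y⟩
  have e : normSOn M w.f = (⨆ x : M, ‖w.f x‖) + ⨆ x : M, ‖w.d x‖ := by
    simp only [normSOn, X.fderiv_eq]
  have n0 : 0 ≤ ⨆ x : M, ‖w.f x‖ := Real.iSup_nonneg fun _ => norm_nonneg _
  have n1 : 0 ≤ ⨆ x : M, ‖w.d x‖ := Real.iSup_nonneg fun _ => norm_nonneg _
  have := q_le (M := M) (u := u) (c := (⨆ x : M, ‖w.f x‖) + ‖u - w‖)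
    (d := (⨆ x : M, ‖w.d x‖) + ‖u - w‖) (by positivity) (by positivity)
    (fun x hx => by
      have h1 := norm_add_le (w.f x) ((u - w).f x)
      have h2 := (u - w).norm_f_le x
      have h3 := le_ciSup hb0 ⟨x, hx⟩
      rw [X.sub_f, add_sub_cancel] at h1
      rw [X.sub_f] at h2
      simp only at h3
      linarith)
    (fun x hx => by
      have h1 := norm_add_le (w.d x) ((u - w).d x)
      have h2 := (u - w).norm_d_le x
      have h3 := le_ciSup hb1 ⟨x, hx⟩
      rw [X.sub_d, add_sub_cancel] at h1
      rw [X.sub_d] at h2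
      simp only at h3
      linarith)
  rw [e]; linarith

lemma q_cont (M : Set E3) : Continuous fun u : X => normSOn M u.f := by
  have : LipschitzWith 2 fun u : X => normSOn M u.f := by
    refine LipschitzWith.of_dist_le_mul fun u w => ?_
    rw [Real.dist_eq, dist_eq_norm, abs_le]
    have h1 := q_sub_le M u w
    have h2 := q_sub_le M w u
    rw [norm_sub_rev] at h2
    simp only [NNReal.coe_ofNat]
    constructor <;> linarith
  exact this.continuous

/-- derivative evaluation -/
def evalD (x : E3) : X →L[ℝ] (E3 →L[ℝ] E3) :=
  LinearMap.mkContinuous (⟨⟨fun u => u.d x, fun _ _ => rfl⟩, fun _ _ => rfl⟩ :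
    X →ₗ[ℝ] (E3 →L[ℝ] E3)) 1 (fun u => by rw [one_mul]; exact u.norm_d_le x)

lemma evalX_apply (x : E3) (u : X) : evalX x u = u.f x := rfl
lemma evalD_apply (x : E3) (u : X) : evalD x u = u.d x := rfl

lemma q_int {M : Set E3} {g : ℝ → X} (hg : Continuous g) {h : ℝ → ℝ} (hh : Continuous h)
    {t : ℝ} (ht : 0 ≤ t) (hb : ∀ s ∈ Icc 0 t, normSOn M (g s).f ≤ h s) :
    normSOn M (∫ s in (0:ℝ)..t, g s).f ≤ 2 * ∫ s in (0:ℝ)..t, h s := by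
  have h0 : 0 ≤ ∫ s in (0:ℝ)..t, h s := intervalIntegral.integral_nonneg ht fun s hs =>
    (normSOn_nonneg _ _).trans (hb s hs)
  rw [two_mul]
  refine q_le h0 h0 (fun x hx => ?_) (fun x hx => ?_)
  · have := (evalX x).intervalIntegral_comp_comm (hg.intervalIntegrable (μ := volume) 0 t)
    rw [evalX_apply] at this
    rw [← this]
    refine intervalIntegral.norm_integral_le_of_norm_le ht (ae_of_all _ fun s hs => ?_)
        (hh.intervalIntegrable _ _)
    exact (q_f (g s) hx).trans (hb s ⟨hs.1.le, hs.2⟩)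
  · have := (evalD x).intervalIntegral_comp_comm (hg.intervalIntegrable (μ := volume) 0 t)
    rw [evalD_apply] at this
    rw [← this]
    refine intervalIntegral.norm_integral_le_of_norm_le ht (ae_of_all _ fun s hs => ?_)
        (hh.intervalIntegrable _ _)
    exact (q_d (g s) hx).trans (hb s ⟨hs.1.le, hs.2⟩)

lemma unif_small {Z : Type*} [NormedAddCommGroup Z] {K : Set E3} (hK : IsCompact K)
    {g : ℕ → E3 → Z} {C : ℝ} (hC : 0 ≤ C) (hl : ∀ n x y, ‖g n x - g n y‖ ≤ C * ‖x - y‖)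
    (hp : ∀ y, Tendsto (fun n => g n y) atTop (𝓝 0)) {ε : ℝ} (hε : 0 < ε) :
    ∀ᶠ n in atTop, ∀ y ∈ K, ‖g n y‖ ≤ ε := by
  obtain ⟨δ, hδ, hδC⟩ : ∃ δ > 0, C * δ ≤ ε / 2 :=
    ⟨ε / 2 / (C + 1), by positivity, by
      rw [← mul_div_assoc, div_le_iff₀ (by positivity)]; nlinarith⟩
  obtain ⟨t, _, htf, hcov⟩ := hK.finite_cover_balls hδ
  have h1 : ∀ᶠ n in atTop, ∀ z ∈ t, ‖g n z‖ ≤ ε / 2 := by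
    rw [htf.eventually_all]
    intro z _
    have := (hp z).norm
    rw [norm_zero] at this
    exact (this.eventually_lt_const (by positivity : 0 < ε / 2)).mono fun n h => h.le
  refine h1.mono fun n hn y hy => ?_
  obtain ⟨z, hz, hyz⟩ := mem_iUnion₂.1 (hcov hy)
  rw [Metric.mem_ball, dist_eq_norm] at hyz
  have h2 := norm_add_le (g n y - g n z) (g n z)
  rw [sub_add_cancel] at h2
  have h3 := hl n y z
  have h4 := mul_le_mul_of_nonneg_left hyz.le hC
  linarith [hn z hz]

lemma weak_fd {V : Type*} [NormedAddCommGroup V] [NormedSpace ℝ V] {Z : Type*}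
    [NormedAddCommGroup Z] [NormedSpace ℝ Z] [FiniteDimensional ℝ Z] {δ : ℕ → V}
    (hw : ∀ l : V →L[ℝ] ℝ, Tendsto (fun n => l (δ n)) atTop (𝓝 0)) (L : V →L[ℝ] Z) :
    Tendsto (fun n => L (δ n)) atTop (𝓝 0) := by
  let e := (Module.finBasis ℝ Z).equivFunL
  have h1 : Tendsto (fun n => e (L (δ n))) atTop (𝓝 0) := by
    rw [tendsto_pi_nhds]
    intro i
    exact hw ((ContinuousLinearMap.proj (R := ℝ) (φ := fun _ => ℝ) i).comp
      (e.toContinuousLinearMap.comp L))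
  have h2 := (e.symm.continuous.tendsto 0).comp h1
  simpa [Function.comp_def] using h2
end restr

section flows2
variable {V : Type*} [NormedAddCommGroup V] [InnerProductSpace ℝ V]
variable (emb : V →ₗ[ℝ] (E3 → E3)) (cV : ℝ) (hcV : 0 < cV)
    (hC0 : ∀ u : V, MemC0 2 (emb u)) (hB : ∀ u : V, normS 2 (emb u) ≤ cV * ‖u‖)

include hB in
lemma q_comp_sub (M : Set E3) (v : V) (u u' : X) :
    normSOn M (compV emb hC0 v u - compV emb hC0 v u').f ≤
      cV * ‖v‖ * (2 + ‖u‖) * normSOn M (u - u').f := by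
  have h0 := (normS_nonneg 2 (emb v))
  have hq := normSOn_nonneg M (u - u').f
  have h1 : normSOn M (compV emb hC0 v u - compV emb hC0 v u').f ≤
      normS 2 (emb v) * (2 + ‖u‖) * normSOn M (u - u').f := by
    have hu := norm_nonneg u
    have := q_le (M := M) (u := compV emb hC0 v u - compV emb hC0 v u')
      (c := normS 2 (emb v) * normSOn M (u - u').f)
      (d := normS 2 (emb v) * ((1 + ‖u‖) * normSOn M (u - u').f))
      (by positivity) (by positivity)
      (fun x hx => (compX_sub_f _ (hC0 v) u u' x).trans
        (mul_le_mul_of_nonneg_left (q_f (u - u') hx) h0))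
      (fun x hx => (compX_sub_d _ (hC0 v) u u' x).trans (mul_le_mul_of_nonneg_left (by
        have h1 := q_fd (u - u') hx
        rw [X.sub_f, X.sub_d] at h1
        have h2 := norm_nonneg (u.d x - u'.d x)
        have h3 := mul_le_mul_of_nonneg_left h1 (by positivity : 0 ≤ 1 + ‖u‖)
        nlinarith) h0))
    refine this.trans (le_of_eq ?_)
    ring
  refine h1.trans ?_
  have := hB v
  gcongr

include hcV hB in
lemma flow_diff {v : ℝ → V} (hv : Continuous v) {T r : ℝ} (hr0 : 0 ≤ r)
    (hr : ∀ t ∈ Icc (0:ℝ) T, ‖v t‖ ≤ r) {u : ℝ → X} (hu : IsFlow emb hC0 v T u)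
    (hub : ∀ t ∈ Icc (0:ℝ) T, ‖u t‖ ≤ Real.exp (cV * r * t) - 1) :
    ∀ t ∈ Icc (0:ℝ) T, ∃ φ : DiffId 1, (∀ x, φ x = x + (u t).f x) ∧
      φ ∈ Sgamma (2 * Real.exp (cV * r * T)) := by
  intro t ht
  have hv' : Continuous fun s => -v (t - s) := by fun_prop
  have hr' : ∀ s ∈ Icc (0:ℝ) t, ‖-v (t - s)‖ ≤ r := fun s hs => by
    rw [norm_neg]; exact hr _ ⟨by linarith [hs.2], by linarith [hs.1, ht.2]⟩
  have hr1 : ∀ s ∈ Icc (0:ℝ) t, ‖v s‖ ≤ r := fun s hs => hr s ⟨hs.1, hs.2.trans ht.2⟩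
  obtain ⟨w, hw, hwb⟩ := exists_flow emb cV hcV hC0 hB hv' ht.1 hr0 hr'
  have hu' : IsFlow emb hC0 v t u := ⟨hu.1, fun s hs => hu.2 s ⟨hs.1, hs.2.trans ht.2⟩⟩
  have hu2 : IsFlow emb hC0 (fun s => -(fun s => -v (t - s)) (t - s)) t u := by
    simpa using hu'
  have h1 := flow_inv emb cV hcV hC0 hB hv ht.1 hr0 hr1 hu' hw
  have h2 := flow_inv emb cV hcV hC0 hB hv' ht.1 hr0 hr' hw hu2
  have he : Real.exp (cV * r * t) ≤ Real.exp (cV * r * T) := by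
    gcongr; exact ht.2
  refine ⟨mkDiff (u t) (w t) h1 h2, fun x => rfl, ?_, ?_⟩
  · have : (fun x => (mkDiff (u t) (w t) h1 h2) x - x) = (u t).f := by
      ext1 x; change x + (u t).f x - x = _; abel
    rw [this]
    refine (X.normS_le _).trans ?_
    linarith [hub t ht]
  · have : (fun x => (mkDiff (u t) (w t) h1 h2).invFun x - x) = (w t).f := by
      ext1 x; change x + (w t).f x - x = _; abel
    rw [this]
    refine (X.normS_le _).trans ?_
    linarith [hwb t ⟨ht.1, le_rfl⟩]

/-- evaluation on V -/
def evV (y : E3) : V →L[ℝ] E3 :=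
  LinearMap.mkContinuous (⟨⟨fun v => emb v y, fun _ _ => by simp⟩, fun _ _ => by simp⟩ : V →ₗ[ℝ] E3)
    cV (fun v => ((hC0 v).le0 y).trans (hB v))

/-- derivative evaluation on V -/
def evDV (y : E3) : V →L[ℝ] (E3 →L[ℝ] E3) :=
  LinearMap.mkContinuous (⟨⟨fun v => fderiv ℝ (emb v) y, fun v w => by
      rw [map_add]
      exact fderiv_add ((hC0 v).diff (by norm_num) y) ((hC0 w).diff (by norm_num) y)⟩, fun c v => by
      change fderiv ℝ (emb (c • v)) y = c • fderiv ℝ (emb v) y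
      rw [map_smul]
      exact fderiv_const_smul ((hC0 v).diff (by norm_num) y) c⟩ : V →ₗ[ℝ] (E3 →L[ℝ] E3))
    cV (fun v => ((hC0 v).le1 (by norm_num) y).trans (hB v))

include hcV hB in
lemma res_weak {M : Set E3} (hM : IsCompact M) {δ : ℕ → V} {D : ℝ} (hD : ∀ n, ‖δ n‖ ≤ D)
    (hw : ∀ l : V →L[ℝ] ℝ, Tendsto (fun n => l (δ n)) atTop (𝓝 0)) (u : X) :
    Tendsto (fun n => normSOn M (compV emb hC0 (δ n) u).f) atTop (𝓝 0) := by
  have hD0 : 0 ≤ D := (norm_nonneg _).trans (hD 0)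
  have hK : IsCompact ((fun x => x + u.f x) '' M) := hM.image (continuous_id.add u.contf)
  have hN : ∀ n, normS 2 (emb (δ n)) ≤ cV * D := fun n =>
    (hB _).trans (mul_le_mul_of_nonneg_left (hD n) hcV.le)
  rw [Metric.tendsto_nhds]
  intro ε hε
  have hu := norm_nonneg u
  obtain ⟨η, hη, hη2⟩ : ∃ η > 0, η + η * (1 + ‖u‖) < ε :=
    ⟨ε / (2 * (2 + ‖u‖)), by positivity, by
      have : ε / (2 * (2 + ‖u‖)) + ε / (2 * (2 + ‖u‖)) * (1 + ‖u‖) = ε / 2 := by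
        field_simp; ring
      linarith⟩
  have h0 := unif_small hK (g := fun n => emb (δ n)) (C := cV * D) (by positivity)
    (fun n x y => ((hC0 _).lip0 (by norm_num) x y).trans
      (mul_le_mul_of_nonneg_right (hN n) (norm_nonneg _)))
    (fun y => weak_fd hw (evV emb cV hC0 hB y)) hη
  have h1 := unif_small hK (g := fun n => fderiv ℝ (emb (δ n))) (C := cV * D) (by positivity)
    (fun n x y => ((hC0 _).lip1 x y).trans
      (mul_le_mul_of_nonneg_right (hN n) (norm_nonneg _)))
    (fun y => weak_fd hw (evDV emb cV hC0 hB y)) hη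
  filter_upwards [h0, h1] with n a0 a1
  rw [dist_zero_right, Real.norm_of_nonneg (normSOn_nonneg _ _)]
  refine lt_of_le_of_lt (q_le hη.le (by positivity) (fun x hx => ?_) fun x hx => ?_) hη2
  · exact a0 _ (mem_image_of_mem _ hx)
  · refine (compX_d_le _ _ _ _).trans ?_
    have := a1 _ (mem_image_of_mem _ hx)
    gcongr
end flows2

lemma DiffId.ext_fun {φ ψ : DiffId 1} (h : ∀ x, φ x = ψ x) : φ = ψ := by
  have h1 : φ.toFun = ψ.toFun := funext h
  have h2 : φ.invFun = ψ.invFun := funext fun y => by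
    have e : φ.toFun (ψ.invFun y) = y := by rw [h1]; exact ψ.right_inv y
    conv_lhs => rw [← e]
    exact φ.left_inv _
  cases φ; cases ψ
  simp only at h1 h2
  subst h1; subst h2; rfl

instance : Nonempty (DiffId 1) :=
  ⟨mkDiff 0 0 (fun x => by simp) (fun x => by simp)⟩

/-- bundled standing assumptions -/
structure Hyp {V : Type*} [NormedAddCommGroup V] [InnerProductSpace ℝ V] {P : Type*}
    [TopologicalSpace P]
    (emb : V →ₗ[ℝ] (E3 → E3)) (cV ω r : ℝ) (A : DiffId 1 → V →L[ℝ] V →L[ℝ] ℝ) (M : Set E3)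
    (Θ : Set P) (jmap : DiffId 1 → P → V →L[ℝ] ℝ) : Prop where
  hcV : 0 < cV
  hC0 : ∀ u : V, MemC0 2 (emb u)
  hB : ∀ u : V, normS 2 (emb u) ≤ cV * ‖u‖
  hM : IsCompact M
  hω : 0 < ω
  hr : 0 ≤ r
  hs : ∀ (φ : DiffId 1) (u w : V), A φ u w = A φ w u
  hp : ∀ (φ : DiffId 1) (u : V), 0 ≤ A φ u u
  lip : ∀ γ > (0 : ℝ), ∃ L ≥ (0 : ℝ), ∀ φ ∈ Sgamma γ, ∀ ψ ∈ Sgamma γ, ∀ θ ∈ Θ, ∀ v v' : V,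
    IsVel (A φ) ω (jmap φ θ) v → IsVel (A ψ) ω (jmap ψ θ) v' →
    ‖v - v'‖ ≤ L * normSOn M fun x => φ x - ψ x
  bd : ∀ φ, ∀ θ ∈ Θ, ∀ v, IsVel (A φ) ω (jmap φ θ) v → ‖v‖ ≤ r
  weak : ∀ (φ : DiffId 1) (θn : ℕ → P) (θ : P), (∀ n, θn n ∈ Θ) → θ ∈ Θ →
        Tendsto θn atTop (𝓝 θ) →
        ∀ w : V, Tendsto (fun n => jmap φ (θn n) w) atTop (𝓝 (jmap φ θ w))

section main
variable {V : Type*} [NormedAddCommGroup V] [InnerProductSpace ℝ V] [CompleteSpace V] {P : Type*}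
    [TopologicalSpace P]
    {emb : V →ₗ[ℝ] (E3 → E3)} {cV ω r : ℝ} {A : DiffId 1 → V →L[ℝ] V →L[ℝ] ℝ} {M : Set E3}
    {Θ : Set P} {jmap : DiffId 1 → P → V →L[ℝ] ℝ}

lemma sub_eq_f {φ ψ : DiffId 1} {u w : X} (h : ∀ x, φ x = x + u.f x) (h' : ∀ x, ψ x = x + w.f x) :
    (fun x => φ x - ψ x) = (u - w).f := by
  ext1 x
  rw [h, h', X.sub_f]; abel

lemma exists_sol (H : Hyp emb cV ω r A M Θ jmap) {T : ℝ} (hT : 0 ≤ T) {θ : P} (hθ : θ ∈ Θ) :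
    ∃ φ v, IsSolutionP emb ω A (fun φ' => jmap φ' θ) T φ v := by
  have hr0 := H.hr
  have hcV := H.hcV
  obtain ⟨b, hb⟩ : ∃ b, b = Real.exp (cV * r * T) := ⟨_, rfl⟩
  have hb0 : 0 < b := hb ▸ Real.exp_pos _
  obtain ⟨L, hL0, hL⟩ := H.lip (2 * b) (by positivity)
  have hflow : ∀ v : ℝ → V, Continuous v ∧ (∀ t ∈ Icc (0:ℝ) T, ‖v t‖ ≤ r) →
      ∃ (u : ℝ → X) (φ : ℝ → DiffId 1), IsFlow emb H.hC0 v T u ∧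
        (∀ t ∈ Icc (0:ℝ) T, ‖u t‖ ≤ b) ∧
        (∀ t ∈ Icc (0:ℝ) T, (∀ x, φ t x = x + (u t).f x) ∧ φ t ∈ Sgamma (2 * b)) := by
    intro v hv
    obtain ⟨u, hu, hub⟩ := exists_flow emb cV hcV H.hC0 H.hB hv.1 hT hr0 hv.2
    have h1 := flow_diff emb cV hcV H.hC0 H.hB hv.1 hr0 hv.2 hu hub
    choose! φ hφ using h1
    refine ⟨u, φ, hu, fun t ht => ?_, by rw [hb]; exact hφ⟩
    have he : Real.exp (cV * r * t) ≤ b := by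
      rw [hb]; gcongr; exact ht.2
    linarith [hub t ht]
  choose! U Q hU hUb hQ using hflow
  choose W hW using fun φ => exists_vel (A φ) (H.hp φ) H.hω (jmap φ θ)
  have key : ∀ v w : ℝ → V, (Continuous v ∧ (∀ t ∈ Icc (0:ℝ) T, ‖v t‖ ≤ r)) →
      (Continuous w ∧ (∀ t ∈ Icc (0:ℝ) T, ‖w t‖ ≤ r)) → ∀ s ∈ Icc 0 T, ∀ t ∈ Icc 0 T,
      ‖W (Q v s) - W (Q w t)‖ ≤ L * (2 * ‖U v s - U w t‖) := by
    intro v w hv hw s hs t ht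
    refine (hL _ (hQ v hv s hs).2 _ (hQ w hw t ht).2 θ hθ _ _ (hW _) (hW _)).trans ?_
    rw [sub_eq_f (hQ v hv s hs).1 (hQ w hw t ht).1]
    exact mul_le_mul_of_nonneg_left (q_le_norm _ _) hL0
  obtain ⟨v, hv, hvb, hve⟩ := volterra (E := V) (T := T)
    (K := L * (2 * (cV * (1 + b) * Real.exp (cV * r * (2 + b) * T)))) hT (by positivity)
    (fun _ => Metric.closedBall 0 r) (fun _ => Metric.isClosed_closedBall)
    (fun t _ => by simpa using hr0)
    (fun v t => W (Q v t))
    (fun v hv hvb => by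
      have hV : Continuous v ∧ (∀ t ∈ Icc (0:ℝ) T, ‖v t‖ ≤ r) :=
        ⟨hv, fun t ht => by simpa using hvb t ht⟩
      refine ⟨fun t₀ ht₀ => ?_, fun t ht => ?_⟩
      · rw [ContinuousWithinAt, tendsto_iff_norm_sub_tendsto_zero]
        have hc : Continuous fun t => L * (2 * ‖U v t - U v t₀‖) := by
          have := (hU v hV).1
          fun_prop
        have hc0 := hc.tendsto t₀
        simp only [sub_self, norm_zero, mul_zero] at hc0
        refine squeeze_zero' (Eventually.of_forall fun _ => norm_nonneg _) ?_
          (hc0.mono_left nhdsWithin_le_nhds)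
        filter_upwards [self_mem_nhdsWithin] with t ht
        exact key v v hV hV t ht t₀ ht₀
      · simpa using H.bd _ θ hθ _ (hW _))
    (fun v w hv hvb hw hwb t ht => by
      have hV : Continuous v ∧ (∀ t ∈ Icc (0:ℝ) T, ‖v t‖ ≤ r) :=
        ⟨hv, fun t ht => by simpa using hvb t ht⟩
      have hV' : Continuous w ∧ (∀ t ∈ Icc (0:ℝ) T, ‖w t‖ ≤ r) :=
        ⟨hw, fun t ht => by simpa using hwb t ht⟩
      refine (key v w hV hV' t ht t ht).trans ?_
      have := flow_lip emb cV hcV H.hC0 H.hB hv hw hr0 hb0.le hV.2 (hU v hV) (hU w hV')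
        (hUb v hV) (hUb w hV') t ht
      calc _ ≤ L * (2 * (cV * (1 + b) * Real.exp (cV * r * (2 + b) * T) *
            ∫ s in (0:ℝ)..t, ‖v s - w s‖)) := by gcongr
        _ = _ := by ring)
  have hV : Continuous v ∧ (∀ t ∈ Icc (0:ℝ) T, ‖v t‖ ≤ r) :=
    ⟨hv, fun t ht => by simpa using hvb t ht⟩
  have hu := hU v hV
  have hq := hQ v hV
  refine ⟨Q v, v, fun t ht => ?_, fun t ht x => ?_, fun t₀ ht₀ => ?_⟩
  · have := hW (Q v t)
    rw [hve t ht] at this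
    exact this
  · have hc := emb_cont emb cV H.hC0 H.hB hv (continuous_const.add (X.cont_eval hu.1 x)) (y := fun t => x + (U v t).f x)
    have e : ∀ s ∈ uIcc 0 t, emb (v s) (x + (U v s).f x) = emb (v s) (Q v s x) := fun s hs => by
      rw [uIcc_of_le ht.1] at hs
      rw [(hq s ⟨hs.1, hs.2.trans ht.2⟩).1]
    constructor
    · exact (hc.intervalIntegrable 0 t).congr fun s hs => e s (uIoc_subset_uIcc hs)
    · rw [← intervalIntegral.integral_congr e, (hq t ht).1,
        flow_eval emb cV H.hC0 H.hB hv hu x t ht]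
  · have hc : Continuous fun t => 2 * ‖U v t - U v t₀‖ := by
      have := hu.1
      fun_prop
    have hc0 := hc.tendsto t₀
    simp only [sub_self, norm_zero, mul_zero] at hc0
    refine squeeze_zero' (Eventually.of_forall fun _ => normS_nonneg _ _) ?_
      (hc0.mono_left nhdsWithin_le_nhds)
    filter_upwards [self_mem_nhdsWithin] with t ht
    rw [distS, sub_eq_f (hq t ht).1 (hq t₀ ht₀).1]
    exact X.normS_le _

lemma sol_flow (H : Hyp emb cV ω r A M Θ jmap) {T : ℝ} (hT : 0 ≤ T) {θ : P} (hθ : θ ∈ Θ)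
    {φ : ℝ → DiffId 1} {v : ℝ → V} (hS : IsSolutionP emb ω A (fun φ' => jmap φ' θ) T φ v) :
    ∃ (v' : ℝ → V) (u : ℝ → X), Continuous v' ∧ (∀ t ∈ Icc 0 T, v' t = v t) ∧
      IsFlow emb H.hC0 v' T u ∧ (∀ t ∈ Icc 0 T, ‖u t‖ ≤ Real.exp (cV * r * T)) ∧
      (∀ t ∈ Icc 0 T, (∀ x, φ t x = x + (u t).f x) ∧ φ t ∈ Sgamma (2 * Real.exp (cV * r * T))) := by
  have hr0 := H.hr
  have hcV := H.hcV
  obtain ⟨h1, h2, h3⟩ := hS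
  have hvc : ContinuousOn v (Icc 0 T) := by
    intro t₀ ht₀
    obtain ⟨ε, hε, γ, hγ, hloc⟩ := Sgamma_local (φ t₀)
    obtain ⟨L, hL0, hL⟩ := H.lip γ hγ
    have h0 : distS 1 (φ t₀) (φ t₀) = 0 := by
      have e := sub_eq_f (φ := φ t₀) (ψ := φ t₀) (u := toX _ (φ t₀).memC0)
        (w := toX _ (φ t₀).memC0) (fun x => by change _ = x + (φ t₀ x - x); abel)
        (fun x => by change _ = x + (φ t₀ x - x); abel)
      refine le_antisymm ?_ (normS_nonneg _ _)
      rw [distS, e]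
      refine (X.normS_le _).trans ?_
      simp
    rw [ContinuousWithinAt, tendsto_iff_norm_sub_tendsto_zero]
    have hd := ((h3 t₀ ht₀).const_mul 2).const_mul L
    simp only [mul_zero] at hd
    refine squeeze_zero' (Eventually.of_forall fun _ => norm_nonneg _) ?_ hd
    filter_upwards [self_mem_nhdsWithin, (h3 t₀ ht₀).eventually_lt_const hε] with t ht hlt
    refine (hL _ (hloc _ hlt.le) _ (hloc _ (by rw [h0]; exact hε.le)) θ hθ _ _ (h1 t ht)
      (h1 t₀ ht₀)).trans ?_
    exact mul_le_mul_of_nonneg_left (normSOn_le_distS _ _ _) hL0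
  let pr : ℝ → ℝ := fun t => (projIcc 0 T hT t : ℝ)
  have hprc : Continuous pr := continuous_subtype_val.comp continuous_projIcc
  have hprm : ∀ t, pr t ∈ Icc 0 T := fun t => (projIcc 0 T hT t).2
  have hpre : ∀ t ∈ Icc 0 T, pr t = t := fun t ht => by
    simp only [pr]; rw [projIcc_of_mem hT ht]
  have hv' : Continuous fun t => v (pr t) := hvc.comp_continuous hprc hprm
  have hb : ∀ t ∈ Icc 0 T, ‖v (pr t)‖ ≤ r := fun t _ => H.bd _ θ hθ _ (h1 _ (hprm t))
  obtain ⟨u, hu, hub⟩ := exists_flow emb cV hcV H.hC0 H.hB hv' hT hr0 hb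
  have hfd := flow_diff emb cV hcV H.hC0 H.hB hv' hr0 hb hu hub
  have hpt : ∀ t ∈ Icc 0 T, ∀ x, φ t x = x + (u t).f x := by
    intro t ht x
    have hyc : ContinuousOn (fun t => φ t x) (Icc 0 T) := by
      intro t₀ ht₀
      rw [ContinuousWithinAt, tendsto_iff_norm_sub_tendsto_zero]
      exact squeeze_zero (fun _ => norm_nonneg _) (fun s => (memC0_sub (φ s) (φ t₀)).le0 x)
        (h3 t₀ ht₀)
    have := point_unique emb cV hcV H.hC0 H.hB hv' hr0 hb (y := fun t => φ (pr t) x)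
      (z := fun t => x + (u t).f x) (hyc.comp_continuous hprc hprm)
      (continuous_const.add (X.cont_eval hu.1 x)) x
      (fun t ht => by
        rw [hpre t ht, (h2 t ht x).2]
        congr 1
        refine intervalIntegral.integral_congr fun s hs => ?_
        rw [uIcc_of_le ht.1] at hs
        rw [hpre s ⟨hs.1, hs.2.trans ht.2⟩])
      (fun t ht => by
        rw [flow_eval emb cV H.hC0 H.hB hv' hu x t ht]) t ht
    simpa [hpre t ht] using this
  refine ⟨_, u, hv', fun t ht => by rw [hpre t ht], hu, fun t ht => ?_, fun t ht => ⟨hpt t ht, ?_⟩⟩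
  · have he : Real.exp (cV * r * t) ≤ Real.exp (cV * r * T) := by gcongr; exact ht.2
    linarith [hub t ht]
  · obtain ⟨ψ, hψ, hψS⟩ := hfd t ht
    have : φ t = ψ := DiffId.ext_fun fun x => by rw [hpt t ht, hψ]
    rwa [this]
end main

lemma q_add (M : Set E3) (u w : X) :
    normSOn M (u + w).f ≤ normSOn M u.f + normSOn M w.f := by
  have hb0 : ∀ w : X, BddAbove (range fun x : M => ‖w.f x‖) := fun w =>
    ⟨‖w‖, by rintro _ ⟨y, rfl⟩; exact w.norm_f_le y⟩
  have hb1 : ∀ w : X, BddAbove (range fun x : M => ‖w.d x‖) := fun w =>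
    ⟨‖w‖, by rintro _ ⟨y, rfl⟩; exact w.norm_d_le y⟩
  have e : ∀ w : X, normSOn M w.f = (⨆ x : M, ‖w.f x‖) + ⨆ x : M, ‖w.d x‖ := fun w => by
    simp only [normSOn, X.fderiv_eq]
  have n0 : ∀ w : X, 0 ≤ ⨆ x : M, ‖w.f x‖ := fun w => Real.iSup_nonneg fun _ => norm_nonneg _
  have n1 : ∀ w : X, 0 ≤ ⨆ x : M, ‖w.d x‖ := fun w => Real.iSup_nonneg fun _ => norm_nonneg _
  have := q_le (M := M) (u := u + w) (add_nonneg (n0 u) (n0 w)) (add_nonneg (n1 u) (n1 w))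
    (fun x hx => (norm_add_le (u.f x) (w.f x)).trans
      (add_le_add (le_ciSup (hb0 u) ⟨x, hx⟩) (le_ciSup (hb0 w) ⟨x, hx⟩)))
    (fun x hx => (norm_add_le (u.d x) (w.d x)).trans
      (add_le_add (le_ciSup (hb1 u) ⟨x, hx⟩) (le_ciSup (hb1 w) ⟨x, hx⟩)))
  rw [e u, e w]; linarith

section main
variable {V : Type*} [NormedAddCommGroup V] [InnerProductSpace ℝ V] [CompleteSpace V] {P : Type*}
    [TopologicalSpace P]
    {emb : V →ₗ[ℝ] (E3 → E3)} {cV ω r : ℝ} {A : DiffId 1 → V →L[ℝ] V →L[ℝ] ℝ} {M : Set E3}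
    {Θ : Set P} {jmap : DiffId 1 → P → V →L[ℝ] ℝ}

lemma cont_theta (H : Hyp emb cV ω r A M Θ jmap) {T : ℝ} (hT : 0 ≤ T) {θn : ℕ → P} {θ : P}
    (hθn : ∀ n, θn n ∈ Θ) (hθ : θ ∈ Θ) (hlim : Tendsto θn atTop (𝓝 θ))
    {φn : ℕ → ℝ → DiffId 1} {vn : ℕ → ℝ → V} {φ : ℝ → DiffId 1} {v : ℝ → V}
    (hSn : ∀ n, IsSolutionP emb ω A (fun φ' => jmap φ' (θn n)) T (φn n) (vn n))
    (hS : IsSolutionP emb ω A (fun φ' => jmap φ' θ) T φ v) :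
    Tendsto (fun n => normSOn M fun x => φn n T x - φ T x) atTop (𝓝 0) := by
  have hr0 := H.hr
  have hcV := H.hcV
  obtain ⟨v', u, hv'c, hv'e, hu, hub, huφ⟩ := sol_flow H hT hθ hS
  choose vn' un hvn'c hvn'e hun hunb hunφ using fun n => sol_flow H hT (hθn n) (hSn n)
  obtain ⟨b, hb⟩ : ∃ b, b = Real.exp (cV * r * T) := ⟨_, rfl⟩
  have hb0 : 0 < b := hb ▸ Real.exp_pos _
  rw [← hb] at hub huφ
  simp only [← hb] at hunb hunφ
  obtain ⟨L, hL0, hL⟩ := H.lip (2 * b) (by positivity)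
  choose W hW using fun n t => exists_vel (A (φ t)) (H.hp (φ t)) H.hω (jmap (φ t) (θn n))
  have hWc : ∀ n, ContinuousOn (W n) (Icc 0 T) := by
    intro n t₀ ht₀
    rw [ContinuousWithinAt, tendsto_iff_norm_sub_tendsto_zero]
    have hc : Continuous fun t => L * (2 * ‖u t - u t₀‖) := by
      have := hu.1
      fun_prop
    have hc0 := hc.tendsto t₀
    simp only [sub_self, norm_zero, mul_zero] at hc0
    refine squeeze_zero' (Eventually.of_forall fun _ => norm_nonneg _) ?_
      (hc0.mono_left nhdsWithin_le_nhds)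
    filter_upwards [self_mem_nhdsWithin] with t ht
    refine (hL _ (huφ t ht).2 _ (huφ t₀ ht₀).2 _ (hθn n) _ _ (hW n t) (hW n t₀)).trans ?_
    rw [sub_eq_f (huφ t ht).1 (huφ t₀ ht₀).1]
    exact mul_le_mul_of_nonneg_left (q_le_norm _ _) hL0
  let pr : ℝ → ℝ := fun t => (projIcc 0 T hT t : ℝ)
  have hprc : Continuous pr := continuous_subtype_val.comp continuous_projIcc
  have hprm : ∀ t, pr t ∈ Icc 0 T := fun t => (projIcc 0 T hT t).2
  have hpre : ∀ t ∈ Icc 0 T, pr t = t := fun t ht => by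
    simp only [pr]; rw [projIcc_of_mem hT ht]
  obtain ⟨δ, hδ⟩ : ∃ δ : ℕ → ℝ → V, ∀ n t, δ n t = W n (pr t) - v' (pr t) :=
    ⟨fun n t => W n (pr t) - v' (pr t), fun _ _ => rfl⟩
  have hδe : ∀ n, ∀ t ∈ Icc 0 T, δ n t = W n t - v' t := fun n t ht => by rw [hδ, hpre t ht]
  have hδc : ∀ n, Continuous (δ n) := fun n => by
    have h1 := ((hWc n).comp_continuous hprc hprm).sub (hv'c.comp hprc)
    exact h1.congr fun t => (hδ n t).symm
  have hvel : ∀ t ∈ Icc 0 T, IsVel (A (φ t)) ω (jmap (φ t) θ) (v' t) := fun t ht => by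
    rw [hv'e t ht]; exact hS.1 t ht
  have hveln : ∀ n, ∀ t ∈ Icc 0 T, IsVel (A (φn n t)) ω (jmap (φn n t) (θn n)) (vn' n t) :=
    fun n t ht => by
      rw [hvn'e n t ht]; exact (hSn n).1 t ht
  have hδb : ∀ n, ∀ t ∈ Icc 0 T, ‖δ n t‖ ≤ r + r := fun n t ht => by
    rw [hδe n t ht]
    exact (norm_sub_le _ _).trans (add_le_add (H.bd _ _ (hθn n) _ (hW n t))
      (H.bd _ _ hθ _ (hvel t ht)))
  obtain ⟨e, he⟩ : ∃ e : ℕ → ℝ → ℝ, ∀ n t, e n t = normSOn M (compV emb H.hC0 (δ n t) (u t)).f :=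
    ⟨_, fun _ _ => rfl⟩
  have hec : ∀ n, Continuous (e n) := fun n => by
    have h1 := (q_cont M).comp (compV_cont emb cV H.hC0 H.hB (hδc n) hu.1)
    exact h1.congr fun t => (he n t).symm
  have he0 : ∀ n t, 0 ≤ e n t := fun n t => by rw [he]; exact normSOn_nonneg _ _
  have het : ∀ t ∈ Icc 0 T, Tendsto (fun n => e n t) atTop (𝓝 0) := fun t ht => by
    simp only [he]
    refine res_weak emb cV hcV H.hC0 H.hB H.hM (fun n => hδb n t ht) (fun l => ?_) (u t)
    have := vel_weak (H.hs (φ t)) (H.hp (φ t)) H.hω (fun n => hW n t) (hvel t ht)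
      (H.weak (φ t) θn θ hθn hθ hlim) l
    refine this.congr fun n => ?_
    rw [hδe n t ht]
  have heb : ∀ n, ∀ t ∈ Icc 0 T, e n t ≤ 2 * (cV * (r + r) * (1 + b)) := fun n t ht => by
    rw [he]
    refine (q_le_norm _ _).trans ?_
    have h1 := compV_norm emb cV H.hC0 H.hB (δ n t) (u t)
    have h2 := hδb n t ht
    have h3 := hub t ht
    refine mul_le_mul_of_nonneg_left (h1.trans ?_) (by norm_num)
    gcongr
  have hct : Tendsto (fun n => ∫ s in (0:ℝ)..T, e n s) atTop (𝓝 0) := by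
    have := intervalIntegral.tendsto_integral_filter_of_dominated_convergence
      (μ := volume) (a := 0) (b := T) (F := e) (f := fun _ => (0:ℝ)) (l := atTop)
      (fun _ => 2 * (cV * (r + r) * (1 + b)))
      (Eventually.of_forall fun n => (hec n).aestronglyMeasurable)
      (Eventually.of_forall fun n => ae_of_all _ fun t ht => by
        rw [uIoc_of_le hT] at ht
        rw [Real.norm_of_nonneg (he0 n t)]
        exact heb n t ⟨ht.1.le, ht.2⟩)
      (continuous_const.intervalIntegrable _ _)
      (ae_of_all _ fun t ht => by
        rw [uIoc_of_le hT] at ht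
        exact het t ⟨ht.1.le, ht.2⟩)
    simpa using this
  obtain ⟨k, hk⟩ : ∃ k, k = cV * r * (2 + b) + 2 * (cV * L * (1 + b)) := ⟨_, rfl⟩
  have hk0 : 0 ≤ k := by rw [hk]; positivity
  have hfin : ∀ n, normSOn M (fun x => φn n T x - φ T x) ≤
      2 * (∫ s in (0:ℝ)..T, e n s) * Real.exp (2 * k * T) := by
    intro n
    rw [sub_eq_f (hunφ n T ⟨hT, le_rfl⟩).1 (huφ T ⟨hT, le_rfl⟩).1]
    have hac : Continuous fun t => normSOn M (un n t - u t).f :=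
      (q_cont M).comp ((hun n).1.sub hu.1)
    have hcu := compV_cont emb cV H.hC0 H.hB hv'c hu.1
    have hcn := compV_cont emb cV H.hC0 H.hB (hvn'c n) (hun n).1
    refine gronwall_int (T := T) hac (by positivity) (fun t ht => ?_) T ⟨hT, le_rfl⟩
    have h1 := q_int (M := M)
      (g := fun s => compV emb H.hC0 (vn' n s) (un n s) - compV emb H.hC0 (v' s) (u s))
      (hcn.sub hcu)
      (h := fun s => k * normSOn M (un n s - u s).f + e n s) (by have := hec n; fun_prop) ht.1
      (fun s hs => by
        have hs' : s ∈ Icc 0 T := ⟨hs.1, hs.2.trans ht.2⟩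
        have eq : compV emb H.hC0 (vn' n s) (un n s) - compV emb H.hC0 (v' s) (u s) =
            (compV emb H.hC0 (vn' n s) (un n s) - compV emb H.hC0 (vn' n s) (u s)) +
            compV emb H.hC0 (vn' n s - W n s) (u s) + compV emb H.hC0 (δ n s) (u s) := by
          rw [hδe n s hs', ← compV_sub_v, ← compV_sub_v]; abel
        rw [eq]
        refine (q_add _ _ _).trans ?_
        rw [← he]
        refine add_le_add_left ((q_add _ _ _).trans ?_) _
        have hq0 := normSOn_nonneg M (un n s - u s).f
        have a1 := q_comp_sub emb cV H.hC0 H.hB M (vn' n s) (un n s) (u s)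
        have a2 := q_le_norm M (compV emb H.hC0 (vn' n s - W n s) (u s))
        have a3 := compV_norm emb cV H.hC0 H.hB (vn' n s - W n s) (u s)
        have a4 := hL _ (hunφ n s hs').2 _ (huφ s hs').2 _ (hθn n) _ _ (hveln n s hs') (hW n s)
        rw [sub_eq_f (hunφ n s hs').1 (huφ s hs').1] at a4
        have a5 := H.bd _ _ (hθn n) _ (hveln n s hs')
        have a6 := hunb n s hs'
        have a7 := hub s hs'
        have a8 : cV * ‖vn' n s‖ * (2 + ‖un n s‖) * normSOn M (un n s - u s).f ≤
            cV * r * (2 + b) * normSOn M (un n s - u s).f := by gcongr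
        have a9 : cV * ‖vn' n s - W n s‖ * (1 + ‖u s‖) ≤
            cV * (L * normSOn M (un n s - u s).f) * (1 + b) := by gcongr
        have a10 : k * normSOn M (un n s - u s).f =
            cV * r * (2 + b) * normSOn M (un n s - u s).f +
            2 * (cV * (L * normSOn M (un n s - u s).f) * (1 + b)) := by rw [hk]; ring
        linarith)
    rw [intervalIntegral.integral_sub (hcn.intervalIntegrable _ _)
      (hcu.intervalIntegrable _ _), ← (hun n).2 t ht, ← hu.2 t ht,
      intervalIntegral.integral_add ((hac.const_mul k).intervalIntegrable _ _)
        ((hec n).intervalIntegrable _ _), intervalIntegral.integral_const_mul] at h1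
    have h2 : ∫ s in (0:ℝ)..t, e n s ≤ ∫ s in (0:ℝ)..T, e n s :=
      intervalIntegral.integral_mono_interval le_rfl ht.1 ht.2
          (ae_of_all _ fun _ => he0 n _) ((hec n).intervalIntegrable _ _)
    linarith
  refine squeeze_zero (fun _ => normSOn_nonneg _ _) hfin ?_
  have := (hct.const_mul 2).mul_const (Real.exp (2 * k * T))
  simpa using this
end main

/-- final assembly -/
lemma exists_min
    {V : Type*} [NormedAddCommGroup V] [InnerProductSpace ℝ V] [CompleteSpace V] {P : Type*}
    [PseudoMetricSpace P]
    {emb : V →ₗ[ℝ] (E3 → E3)} {cV ω r : ℝ} {A : DiffId 1 → V →L[ℝ] V →L[ℝ] ℝ} {M : Set E3}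
    {Θ : Set P} {jmap : DiffId 1 → P → V →L[ℝ] ℝ} (H : Hyp emb cV ω r A M Θ jmap)
    (hΘ : IsCompact Θ) (hne : Θ.Nonempty) {T : ℝ} (hT : 0 ≤ T) (R : DiffId 1 → ℝ)
    (hR : ∀ (φ : DiffId 1) (φn : ℕ → DiffId 1),
        Tendsto (fun n => normSOn M fun x => φn n x - φ x) atTop (𝓝 0) →
        Tendsto (fun n => R (φn n)) atTop (𝓝 (R φ))) :
    ∃ θ ∈ Θ, ∃ (φ : ℝ → DiffId 1) (v : ℝ → V),
      IsSolutionP emb ω A (fun φ' => jmap φ' θ) T φ v ∧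
      ∀ θ' ∈ Θ, ∀ (φ' : ℝ → DiffId 1) (v' : ℝ → V),
        IsSolutionP emb ω A (fun φ'' => jmap φ'' θ') T φ' v' → R (φ T) ≤ R (φ' T) := by
  have hex : ∀ θ ∈ Θ, ∃ φ v, IsSolutionP emb ω A (fun φ' => jmap φ' θ) T φ v :=
    fun θ hθ => exists_sol H hT hθ
  choose! F v hF using hex
  have hc : ContinuousOn (fun θ => R (F θ T)) Θ := by
    rw [continuousOn_iff_continuous_domRestrict, continuous_iff_seqContinuous]
    intro xs x hx
    have hx' : Tendsto (fun n => (xs n : P)) atTop (𝓝 (x : P)) :=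
      (continuous_subtype_val.tendsto x).comp hx
    exact hR _ _ (cont_theta H hT (fun n => (xs n).2) x.2 hx' (fun n => hF _ (xs n).2)
      (hF _ x.2))
  obtain ⟨θ, hθ, hmin⟩ := hΘ.exists_isMinOn hne hc
  refine ⟨θ, hθ, F θ, v θ, hF θ hθ, fun θ' hθ' φ' v' hS => ?_⟩
  have h1 : R (F θ T) ≤ R (F θ' T) := hmin hθ'
  have h2 := hR _ _ (cont_theta H hT (θn := fun _ => θ') (fun _ => hθ') hθ' tendsto_const_nhds
    (φn := fun _ => F θ') (vn := fun _ => v θ') (fun n => hF _ hθ') hS)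
  rwa [tendsto_nhds_unique tendsto_const_nhds h2] at h1

/-- **Theorem 3.2(ii) (parametric yank model: existence of an optimal parameter).**
Under the stated assumptions on `A`, on the parametrized yank `j(·,·)`, and on the
discrepancy `ρ`, the function `θ ↦ ρ(φ_θ(T)(M₀), M_targ)` attains its minimum on the
compact set `Θ`. -/
theorem parametric_yank_optimal_parameter_existence
    {V : Type*} [NormedAddCommGroup V] [InnerProductSpace ℝ V] [CompleteSpace V]
    [TopologicalSpace.SeparableSpace V]
    (emb : V →ₗ[ℝ] (E3 → E3)) (cV : ℝ) (hcV : 0 < cV)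
    (hembC0 : ∀ u : V, MemC0 2 (emb u))
    (hembBound : ∀ u : V, normS 2 (emb u) ≤ cV * ‖u‖)
    (M₀ Mtarg : Set E3) (hM₀ : IsCompact M₀) (hMtarg : IsCompact Mtarg)
    (ω : ℝ) (hω : 0 < ω)
    (A : DiffId 1 → V →L[ℝ] V →L[ℝ] ℝ)
    (hAsymm : ∀ (φ : DiffId 1) (u w : V), A φ u w = A φ w u)
    (hApos : ∀ (φ : DiffId 1) (u : V), 0 ≤ A φ u u)
    (hAlip : ∀ φ₀ : DiffId 1, ∃ r > 0, ∃ ℓ > 0, ∀ φ ψ : DiffId 1,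
      distS 1 φ φ₀ ≤ r → distS 1 ψ φ₀ ≤ r → ‖A φ - A ψ‖ ≤ ℓ * distS 1 φ ψ)
    (hAlipS : ∀ γ > (0 : ℝ), ∃ ℓ > (0 : ℝ), ∀ φ ∈ Sgamma γ, ∀ ψ ∈ Sgamma γ,
      ‖A φ - A ψ‖ ≤ ℓ * normSOn M₀ fun x => φ x - ψ x)
    (m : ℕ) (Θ : Set (EuclideanSpace ℝ (Fin m)))
    (hΘ : IsCompact Θ) (hΘne : Θ.Nonempty)
    (jmap : DiffId 1 → EuclideanSpace ℝ (Fin m) → V →L[ℝ] ℝ)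
    (hjlipS : ∀ γ > (0 : ℝ), ∃ ℓ > (0 : ℝ), ∀ φ ∈ Sgamma γ, ∀ ψ ∈ Sgamma γ, ∀ θ ∈ Θ,
      ‖jmap φ θ - jmap ψ θ‖ ≤ ℓ * normSOn M₀ fun x => φ x - ψ x)
    (hjweak : ∀ (φ : DiffId 1) (θn : ℕ → EuclideanSpace ℝ (Fin m))
        (θ : EuclideanSpace ℝ (Fin m)), (∀ n, θn n ∈ Θ) → θ ∈ Θ →
        Tendsto θn atTop (𝓝 θ) →
        ∀ w : V, Tendsto (fun n => jmap φ (θn n) w) atTop (𝓝 (jmap φ θ w)))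
    (JΘ : ℝ) (hJΘ : ∀ (φ : DiffId 1), ∀ θ ∈ Θ, ‖jmap φ θ‖ ≤ JΘ)
    (ρ : Set E3 → Set E3 → ℝ)
    (hρ0 : ∀ M M' : Set E3, 0 ≤ ρ M M')
    (hρcont : ∀ (M M' : Set E3), IsCompact M → IsCompact M' →
      ∀ (φ : DiffId 1) (φn : ℕ → DiffId 1),
        Tendsto (fun n => normSOn M fun x => φn n x - φ x) atTop (𝓝 0) →
        Tendsto (fun n => ρ ((φn n).toFun '' M) M') atTop (𝓝 (ρ (φ.toFun '' M) M')))
    (T : ℝ) (hT : 0 < T) :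
    ∃ θ ∈ Θ, ∃ (φ : ℝ → DiffId 1) (v : ℝ → V),
      IsSolutionP emb ω A (fun φ' => jmap φ' θ) T φ v ∧
      ∀ θ' ∈ Θ, ∀ (φ' : ℝ → DiffId 1) (v' : ℝ → V),
        IsSolutionP emb ω A (fun φ'' => jmap φ'' θ') T φ' v' →
        ρ ((φ T).toFun '' M₀) Mtarg ≤ ρ ((φ' T).toFun '' M₀) Mtarg := by
  have hJ0 : 0 ≤ JΘ := by
    obtain ⟨θ, hθ⟩ := hΘne
    obtain ⟨φ⟩ : Nonempty (DiffId 1) := inferInstance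
    exact (norm_nonneg _).trans (hJΘ φ θ hθ)
  have hbd : ∀ φ, ∀ θ ∈ Θ, ∀ v, IsVel (A φ) ω (jmap φ θ) v → ‖v‖ ≤ JΘ / ω := by
    intro φ θ hθ v hv
    refine (vel_norm (hApos φ) hω hv).trans ?_
    have := hJΘ φ θ hθ
    gcongr
  have H : Hyp emb cV ω (JΘ / ω) A M₀ Θ jmap :=
    { hcV := hcV
      hC0 := hembC0
      hB := hembBound
      hM := hM₀
      hω := hω
      hr := by positivity
      hs := hAsymm
      hp := hApos
      lip := by
        intro γ hγ
        obtain ⟨l1, hl1, h1⟩ := hAlipS γ hγ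
        obtain ⟨l2, hl2, h2⟩ := hjlipS γ hγ
        refine ⟨(l2 + l1 * (JΘ / ω)) / ω, by positivity, fun φ hφ ψ hψ θ hθ v v' hv hv' => ?_⟩
        refine (vel_diff (hApos φ) hω hv hv').trans ?_
        have a1 := h1 φ hφ ψ hψ
        have a2 := h2 φ hφ ψ hψ θ hθ
        have a3 := hbd ψ θ hθ v' hv'
        have a0 := normSOn_nonneg M₀ fun x => φ x - ψ x
        have a4 := mul_le_mul a1 a3 (norm_nonneg _) (by positivity)
        rw [div_mul_eq_mul_div]
        refine div_le_div_of_nonneg_right ?_ hω.le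
        linarith
      bd := hbd
      weak := hjweak }
  exact exists_min H hΘ hΘne hT.le (fun φ => ρ (φ.toFun '' M₀) Mtarg)
    (hρcont M₀ Mtarg hM₀ hMtarg)

end
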